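/- arXiv:2407.07193 — 3 statements merged into one kernel-verified Lean document; each statement's English description precedes it below -/
import Mathlib

section
/- Let a_1,…,a_r be positive integers with least common multiple A. For every ε > 0 there exists N such that for every prime power q with gcd(q,A) = 1 and every integer n > N, one has | J_{q,n}(a_1,…,a_r) · q^{−(r − 1/a_1 − … − 1/a_r)·n²} − Σ_{(k_1,…,k_r) ∈ Σ(a_1,…,a_r)} ∏_{i=1}^r C_{q,n,k_i}(a_i) | < ε, where Σ(a_1,…,a_r) := {(k_1,…,k_r) ∈ (ℤ/a_1ℤ) × … × (ℤ/a_rℤ) : ζ_{a_1}^{k_1}⋯ζ_{a_r}^{k_r} = 1}, with ζ_{a_i} := ζ^{A/a_i} for a fixed primitive A-th root of unity ζ in the algebraic closure of F_q. -/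
open scoped MatrixGroups

/-- `S` is a set of representatives for the orbits of multiplication by `q` on `ℤ/aℤ`. -/
def IsOrbitRepSet (a q : ℕ) (S : Finset (ZMod a)) : Prop :=
  ∀ i : ZMod a, ∃! s, s ∈ S ∧ ∃ e : ℕ, (q : ZMod a) ^ e * s = i

/-- The size `l_s` of the orbit of `s` under multiplication by `q` on `ℤ/aℤ`. -/
noncomputable def orbitSize (a q : ℕ) (s : ZMod a) : ℕ :=
  Nat.card {x : ZMod a // ∃ e : ℕ, (q : ZMod a) ^ e * s = x}

/-- The constant `C_{q,n,k}(a)`, relative to a set `S` of representatives of the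
orbits of multiplication by `q` on `ℤ/aℤ`. -/
noncomputable def Cconst (a q n : ℕ) (k : ZMod a) (S : Finset (ZMod a)) : ℝ :=
  ((∏' j : ℕ, (1 - (q : ℝ) ^ (-(j + 1 : ℝ)))) /
      ∏ s ∈ S, ∏' j : ℕ, (1 - (q : ℝ) ^ (-((orbitSize a q s : ℝ) * (j + 1 : ℝ))))) *
    ∑' m : {m : ZMod a → ℤ //
        (∀ i, m ((q : ZMod a) * i) = m i) ∧ (∑ᶠ i, m i) = (n : ℤ) ∧
        (∑ᶠ i : ZMod a, i * (m i : ZMod a)) = k},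
      (q : ℝ) ^ (-(∑ᶠ i : ZMod a, ((m.1 i : ℝ) - (n : ℝ) / (a : ℝ)) ^ 2))

/-- `J_{q,n}(a₁,…,a_r)`: the number of `r`-tuples `(t₁,…,t_r)` of elements of
`GL_n(F_q)` with `tᵢ^{aᵢ} = 1` for all `i` and `det(t₁)⋯det(t_r) = 1`. -/
noncomputable def Jcard (F : Type) [Field F] [Fintype F] (n r : ℕ) (a : Fin r → ℕ) : ℕ :=
  Nat.card {t : Fin r → GL (Fin n) F //
    (∀ i, t i ^ a i = 1) ∧ ∏ i, ((t i : Matrix (Fin n) (Fin n) F).det) = 1}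

section Blocks

variable {R ι : Type*} [CommRing R] [Fintype ι] [DecidableEq ι]
  {M M' : ι → Type*} [∀ i, AddCommGroup (M i)] [∀ i, Module R (M i)]
  [∀ i, AddCommGroup (M' i)] [∀ i, Module R (M' i)]

/-- The `i`-th diagonal block of a linear map between products. -/
def diagBlock (g : (∀ i, M i) →ₗ[R] ∀ i, M' i) (i : ι) : M i →ₗ[R] M' i :=
  LinearMap.proj i ∘ₗ g ∘ₗ LinearMap.single R M i

theorem apply_eq_diagBlock {f : ι → R} (hf : Pairwise (Function.onFun IsCoprime f))
    (hM : ∀ i, Module.IsTorsionBy R (M i) (f i)) (hM' : ∀ i, Module.IsTorsionBy R (M' i) (f i))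
    (g : (∀ i, M i) →ₗ[R] ∀ i, M' i) (v : ∀ i, M i) (i : ι) :
    g v i = diagBlock g i (v i) := by
  have hv : v = ∑ j, Pi.single j (v j) := (Finset.univ_sum_single v).symm
  conv_lhs => rw [hv, map_sum, Finset.sum_apply]
  rw [Finset.sum_eq_single i]
  · rfl
  · intro j _ hj
    obtain ⟨x, y, hxy⟩ := hf hj
    have h1 : f j • g (Pi.single j (v j)) i = 0 := by
      rw [← Pi.smul_apply, ← map_smul, ← Pi.single_smul, hM j]
      simp
    have h2 : f i • g (Pi.single j (v j)) i = 0 := by apply hM'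
    rw [← one_smul R (g (Pi.single j (v j)) i), ← hxy, add_smul, mul_smul, mul_smul, h1, h2]
    simp
  · simp

/-- Linear equivalences between products of modules with pairwise coprime annihilators are
block diagonal. -/
def piLinearEquivEquiv {f : ι → R} (hf : Pairwise (Function.onFun IsCoprime f))
    (hM : ∀ i, Module.IsTorsionBy R (M i) (f i)) (hM' : ∀ i, Module.IsTorsionBy R (M' i) (f i)) :
    ((∀ i, M i) ≃ₗ[R] ∀ i, M' i) ≃ ∀ i, M i ≃ₗ[R] M' i where
  toFun g i := LinearEquiv.ofLinearMap (diagBlock g.toLinearMap i) (diagBlock g.symm.toLinearMap i)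
    (by
      ext x
      have := apply_eq_diagBlock hf hM hM' g.toLinearMap (g.symm (Pi.single i x)) i
      have h2 := apply_eq_diagBlock hf hM' hM g.symm.toLinearMap (Pi.single i x) i
      simp only [LinearEquiv.coe_coe, LinearEquiv.apply_symm_apply, Pi.single_eq_same] at this h2
      simp only [LinearMap.comp_apply, LinearMap.id_apply, ← h2, ← this])
    (by
      ext x
      have := apply_eq_diagBlock hf hM' hM g.symm.toLinearMap (g (Pi.single i x)) i
      have h2 := apply_eq_diagBlock hf hM hM' g.toLinearMap (Pi.single i x) i
      simp only [LinearEquiv.coe_coe, LinearEquiv.symm_apply_apply, Pi.single_eq_same] at this h2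
      simp only [LinearMap.comp_apply, LinearMap.id_apply, ← h2, ← this])
  invFun e := LinearEquiv.piCongrRight e
  left_inv g := by
    ext v i
    exact (apply_eq_diagBlock hf hM hM' g.toLinearMap v i).symm
  right_inv e := by
    ext i x
    simp [diagBlock]

/-- The module `∏ i, (R / f i) ^ (m i)`. -/
abbrev BlockModule (f : ι → R) (m : ι → ℕ) : Type _ :=
  ∀ i, Fin (m i) → R ⧸ Ideal.span {f i}

omit [Fintype ι] [DecidableEq ι] in
theorem isTorsionBy_block (f : ι → R) (m : ι → ℕ) (i : ι) :
    Module.IsTorsionBy R (Fin (m i) → R ⧸ Ideal.span {f i}) (f i) := by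
  intro x
  ext j
  obtain ⟨y, hy⟩ := Ideal.Quotient.mk_surjective (x j)
  rw [Pi.smul_apply, ← hy, Pi.zero_apply, ← Ideal.Quotient.mk_eq_mk, ← Submodule.Quotient.mk_smul,
    Ideal.Quotient.mk_eq_mk, Ideal.Quotient.eq_zero_iff_mem, smul_eq_mul]
  exact Ideal.mul_mem_right _ _ (Ideal.mem_span_singleton_self _)

theorem natCard_linearEquiv_pow_quotient (I : Ideal R) (n : ℕ) :
    Nat.card ((Fin n → R ⧸ I) ≃ₗ[R] (Fin n → R ⧸ I)) = Nat.card (GL (Fin n) (R ⧸ I)) := by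
  have h : Function.Surjective (algebraMap R (R ⧸ I)) := Ideal.Quotient.mk_surjective
  let e1 : ((Fin n → R ⧸ I) ≃ₗ[R] (Fin n → R ⧸ I)) ≃
      ((Fin n → R ⧸ I) ≃ₗ[R ⧸ I] (Fin n → R ⧸ I)) :=
    { toFun := fun g => g.extendScalarsOfSurjective h
      invFun := fun g => g.restrictScalars R
      left_inv := fun g => by ext; rfl
      right_inv := fun g => by ext; rfl }
  exact Nat.card_congr (e1.trans ((LinearMap.GeneralLinearGroup.generalLinearEquiv _ _).symm.trans
    (Matrix.GeneralLinearGroup.toLin (n := Fin n) (R := R ⧸ I)).symm).toEquiv)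

theorem natCard_linearEquiv_blockModule {f : ι → R}
    (hf : Pairwise (Function.onFun IsCoprime f)) (m : ι → ℕ) :
    Nat.card (BlockModule f m ≃ₗ[R] BlockModule f m) =
      ∏ i, Nat.card (GL (Fin (m i)) (R ⧸ Ideal.span {f i})) := by
  rw [Nat.card_congr (piLinearEquivEquiv hf (isTorsionBy_block f m) (isTorsionBy_block f m)),
    Nat.card_pi]
  exact Finset.prod_congr rfl fun i _ => natCard_linearEquiv_pow_quotient _ _

theorem blockModule_equiv_unique {f : ι → R}
    (hf : Pairwise (Function.onFun IsCoprime f)) [∀ i, Finite (R ⧸ Ideal.span {f i})]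
    [∀ i, Nontrivial (R ⧸ Ideal.span {f i})] {m m' : ι → ℕ}
    (e : BlockModule f m ≃ₗ[R] BlockModule f m') : m = m' := by
  ext i
  have e' := piLinearEquivEquiv hf (isTorsionBy_block f m) (isTorsionBy_block f m') e i
  have h := Nat.card_congr e'.toEquiv
  simp only [Nat.card_fun, Nat.card_fin] at h
  exact Nat.pow_right_injective (Finite.one_lt_card (α := R ⧸ Ideal.span {f i})) h

theorem exists_equiv_blockModule [IsDomain R] [IsPrincipalIdealRing R] {f : ι → R}
    (hf : Pairwise (Function.onFun IsCoprime f)) (hirr : ∀ i, Irreducible (f i))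
    {N : Type*} [AddCommGroup N] [Module R N] [Finite N]
    (hN : Module.IsTorsionBy R N (∏ i, f i)) :
    ∃ m : ι → ℕ, Nonempty (BlockModule f m ≃ₗ[R] N) := by
  have hint := Submodule.torsionBy_isInternal (S := Finset.univ) (q := f) (M := N)
    (fun i _ j _ hij => hf hij) hN
  have key : ∀ i, ∃ k : ℕ, Nonempty ((Fin k → R ⧸ Ideal.span {f i}) ≃ₗ[R]
      Submodule.torsionBy R N (f i)) := by
    intro i
    have : (Ideal.span {f i}).IsMaximal :=
      PrincipalIdealRing.isMaximal_of_irreducible (hirr i)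
    have hset : Module.IsTorsionBySet R (Submodule.torsionBy R N (f i))
        (Ideal.span {f i} : Ideal R) :=
      (Module.isTorsionBySet_span_singleton_iff (f i)).mpr
        (Submodule.torsionBy_isTorsionBy (R := R) (M := N) (f i))
    let _ : Field (R ⧸ Ideal.span {f i}) := Ideal.Quotient.field _
    let _ : Module (R ⧸ Ideal.span {f i}) (Submodule.torsionBy R N (f i)) := hset.module
    have : IsScalarTower R (R ⧸ Ideal.span {f i}) (Submodule.torsionBy R N (f i)) :=
      hset.isScalarTower
    exact ⟨_, ⟨((Module.finBasis (R ⧸ Ideal.span {f i})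
      (Submodule.torsionBy R N (f i))).equivFun.symm).restrictScalars R⟩⟩
  choose k hk using key
  refine ⟨k, ⟨?_⟩⟩
  let e1 : BlockModule f k ≃ₗ[R] ∀ i : ι, Submodule.torsionBy R N (f i) :=
    LinearEquiv.piCongrRight fun i => (hk i).some
  let e2 : (∀ i : (Finset.univ : Finset ι), Submodule.torsionBy R N (f i)) ≃ₗ[R]
      ∀ i : ι, Submodule.torsionBy R N (f i) :=
    LinearEquiv.piCongrLeft R (fun i : ι => Submodule.torsionBy R N (f i))
      (Equiv.subtypeUnivEquiv Finset.mem_univ)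
  exact (e1.trans e2.symm).trans
    ((DirectSum.linearEquivFunOnFintype R _ _).symm.trans
      (LinearEquiv.ofBijective (DirectSum.coeLinearMap _) hint))

end Blocks

section Transport

open Polynomial

variable {F N V : Type*} [Field F] [AddCommGroup N] [Module F N]
    [Module F[X] N] [IsScalarTower F F[X] N] [AddCommGroup V] [Module F V]

/-- `F`-linear isomorphisms transporting the action of `X` to `t` are the `F[X]`-linear
isomorphisms to the module defined by `t`. -/
noncomputable def conjFiberEquiv (t : Module.End F V) :
    {e : N ≃ₗ[F] V // e.conj (Algebra.lsmul F F N (X : F[X])) = t} ≃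
      (Module.AEval' t ≃ₗ[F[X]] N) where
  toFun e := LinearEquiv.ofAEval _ e.1.symm fun v => by
    change e.1.symm (t v) = _
    rw [← LinearMap.congr_fun e.2 v]
    simp [LinearEquiv.conj_apply]
  invFun g := ⟨((g.restrictScalars F).symm.trans (Module.AEval'.of t).symm), by
    ext v
    have h := g.map_smul X (Module.AEval'.of t v)
    rw [Module.AEval'.X_smul_of] at h
    simp only [LinearEquiv.conj_apply, LinearMap.comp_apply, LinearEquiv.coe_coe,
      LinearEquiv.trans_apply, LinearEquiv.trans_symm, LinearEquiv.symm_symm, Algebra.lsmul_coe,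
      LinearEquiv.restrictScalars_apply, LinearEquiv.restrictScalars_symm_apply]
    rw [← h]
    simp⟩
  left_inv e := by
    ext x
    rfl
  right_inv g := by
    ext x
    rfl

variable [Finite N] [Finite V]

/-- Orbit–stabilizer count of the endomorphisms of `V` whose module is isomorphic to `N`. -/
theorem natCard_end_mul_natCard_aut (h : Nonempty (N ≃ₗ[F] V)) :
    Nat.card {t : Module.End F V // Nonempty (N ≃ₗ[F[X]] Module.AEval' t)} *
      Nat.card (N ≃ₗ[F[X]] N) = Nat.card (V ≃ₗ[F] V) := by
  classical
  have : Finite (V ≃ₗ[F] V) := DFunLike.finite _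
  have : Finite (N ≃ₗ[F] V) := DFunLike.finite _
  have : Finite (Module.End F V) := DFunLike.finite _
  have : Finite (N ≃ₗ[F[X]] N) := DFunLike.finite _
  obtain ⟨e0⟩ := h
  let e1 : (V ≃ₗ[F] V) ≃ (N ≃ₗ[F] V) :=
    { toFun := fun g => e0.trans g
      invFun := fun g => e0.symm.trans g
      left_inv := fun g => by ext; simp
      right_inv := fun g => by ext; simp }
  let Φ : (N ≃ₗ[F] V) → {t : Module.End F V // Nonempty (N ≃ₗ[F[X]] Module.AEval' t)} :=
    fun e => ⟨e.conj (Algebra.lsmul F F N (X : F[X])), ⟨(conjFiberEquiv _ ⟨e, rfl⟩).symm⟩⟩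
  rw [Nat.card_congr e1, ← Nat.card_congr (Equiv.sigmaFiberEquiv Φ)]
  have := Fintype.ofFinite {t : Module.End F V // Nonempty (N ≃ₗ[F[X]] Module.AEval' t)}
  rw [Nat.card_sigma, Nat.card_eq_fintype_card, ← smul_eq_mul, ← Finset.card_univ,
    ← Finset.sum_const]
  refine Finset.sum_congr rfl fun t _ => ?_
  obtain ⟨t, ⟨g⟩⟩ := t
  have e2 : {e // Φ e = ⟨t, ⟨g⟩⟩} ≃
      {e : N ≃ₗ[F] V // e.conj (Algebra.lsmul F F N (X : F[X])) = t} :=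
    Equiv.subtypeEquivRight fun e => by simp [Φ]
  rw [Nat.card_congr e2, Nat.card_congr (conjFiberEquiv t)]
  exact Nat.card_congr
    { toFun := fun k => g.symm.trans k
      invFun := fun k => g.trans k
      left_inv := fun k => by ext; simp
      right_inv := fun k => by ext; simp }

end Transport

section Det

open Polynomial

theorem Matrix.det_blockDiagonal_sigma {ι R : Type*} [Fintype ι] [DecidableEq ι] [CommRing R]
    {κ : ι → Type*} [∀ i, Fintype (κ i)] [∀ i, DecidableEq (κ i)]
    (A : ∀ i, Matrix (κ i) (κ i) R) :
    (Matrix.blockDiagonal' A).det = ∏ i, (A i).det := by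
  let _ : LinearOrder ι := LinearOrder.lift' (Fintype.equivFin ι) (Fintype.equivFin ι).injective
  have h := Matrix.blockTriangular_blockDiagonal' A
  have h2 := Matrix.BlockTriangular.det_fintype h
  convert h2 using 2 with i
  rw [← Matrix.det_submatrix_equiv_self (Equiv.sigmaSubtype i).symm]
  congr 1
  ext x y
  simp [Matrix.toSquareBlock_def, Equiv.sigmaSubtype]

theorem LinearMap.det_piMap {ι R : Type*} [Fintype ι] [CommRing R] {M : ι → Type*}
    [∀ i, AddCommGroup (M i)] [∀ i, Module R (M i)] [∀ i, Module.Free R (M i)]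
    [∀ i, Module.Finite R (M i)] (f : ∀ i, M i →ₗ[R] M i) :
    (LinearMap.piMap f).det = ∏ i, (f i).det := by
  classical
  let b := fun i => Module.Free.chooseBasis R (M i)
  simp_rw [← LinearMap.det_toMatrix (Pi.basis b)]
  have h : LinearMap.toMatrix (Pi.basis b) (Pi.basis b) (LinearMap.piMap f) =
      Matrix.blockDiagonal' fun i => LinearMap.toMatrix (b i) (b i) (f i) := by
    ext ⟨i₁, i₂⟩ ⟨j₁, j₂⟩
    rw [LinearMap.toMatrix_apply, Pi.basis_apply, Pi.basis_repr, Matrix.blockDiagonal'_apply]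
    by_cases h : i₁ = j₁
    · subst h
      simp [LinearMap.toMatrix_apply]
    · simp [LinearMap.piMap, h]
  rw [h, Matrix.det_blockDiagonal_sigma]
  exact Finset.prod_congr rfl fun i _ => LinearMap.det_toMatrix _ _

variable {F ι : Type*} [Field F] [Fintype ι] (f : ι → F[X]) [∀ i, Fact (Irreducible (f i))]

theorem det_lsmul_X_blockModule (m : ι → ℕ) :
    LinearMap.det (Algebra.lsmul F F (BlockModule f m) (X : F[X])) =
      ∏ i, (Algebra.norm F (AdjoinRoot.root (f i))) ^ m i := by
  have : ∀ i, Module.Finite F (F[X] ⧸ Ideal.span {f i}) := fun i =>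
    (AdjoinRoot.powerBasis (Fact.out (p := Irreducible (f i))).ne_zero).finite
  have h : Algebra.lsmul F F (BlockModule f m) (X : F[X]) =
      LinearMap.piMap fun i => LinearMap.piMap fun _ : Fin (m i) =>
        Algebra.lmul F (F[X] ⧸ Ideal.span {f i}) (Ideal.Quotient.mk _ X) := by
    ext v i j
    rfl
  rw [h, LinearMap.det_piMap]
  refine Finset.prod_congr rfl fun i _ => ?_
  rw [LinearMap.det_piMap, Finset.prod_const, Finset.card_univ, Fintype.card_fin]
  rfl

end Det

section Count

open Polynomial

variable {F ι V : Type*} [Field F] {f : ι → F[X]} [AddCommGroup V] [Module F V] {a : ℕ}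

theorem finrank_quotient_span_irreducible (i : ι) :
    Module.finrank F (F[X] ⧸ Ideal.span {f i}) = (f i).natDegree :=
  finrank_quotient_span_eq_natDegree

variable [hirr : ∀ i, Fact (Irreducible (f i))] [Fintype ι]

omit [Fintype ι] in
instance finite_quotient_span_irreducible (i : ι) :
    Module.Finite F (F[X] ⧸ Ideal.span {f i}) :=
  (AdjoinRoot.powerBasis (hirr i).out.ne_zero).finite

omit hirr in
theorem pow_eq_one_of_equiv_blockModule (h : ∏ i, f i ∣ X ^ a - 1) {t : Module.End F V} {m : ι → ℕ}
    (e : BlockModule f m ≃ₗ[F[X]] Module.AEval' t) : t ^ a = 1 := by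
  have h1 : ∀ x : BlockModule f m, (X ^ a - 1 : F[X]) • x = 0 := by
    intro x
    ext1 i
    obtain ⟨c, hc⟩ := (Finset.dvd_prod_of_mem f (Finset.mem_univ i)).trans h
    rw [Pi.smul_apply, hc, mul_comm, mul_smul, @isTorsionBy_block _ _ _ f m i (x i)]
    simp
  ext v
  have h2 := h1 (e.symm (Module.AEval'.of t v))
  rw [← map_smul, LinearEquiv.map_eq_zero_iff, sub_smul, Module.AEval'.X_pow_smul_of, one_smul,
    sub_eq_zero] at h2
  simpa using h2

theorem det_of_equiv_blockModule {t : Module.End F V} {m : ι → ℕ}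
    (e : BlockModule f m ≃ₗ[F[X]] Module.AEval' t) :
    LinearMap.det t = ∏ i, (Algebra.norm F (AdjoinRoot.root (f i))) ^ m i := by
  rw [← det_lsmul_X_blockModule]
  let e' : BlockModule f m ≃ₗ[F] V := (e.restrictScalars F).trans (Module.AEval'.of t).symm
  rw [← LinearMap.det_conj _ e']
  congr 1
  ext v
  simp [e']

theorem finrank_blockModule (m : ι → ℕ) :
    Module.finrank F (BlockModule f m) = ∑ i, (f i).natDegree * m i := by
  rw [Module.finrank_pi_fintype]
  refine Finset.sum_congr rfl fun i _ => ?_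
  rw [Module.finrank_pi_fintype, Finset.sum_const, finrank_quotient_span_irreducible]
  simp [mul_comm]

theorem finrank_of_equiv_blockModule {t : Module.End F V} {m : ι → ℕ}
    (e : BlockModule f m ≃ₗ[F[X]] Module.AEval' t) :
    ∑ i, (f i).natDegree * m i = Module.finrank F V := by
  rw [← finrank_blockModule]
  exact ((e.restrictScalars F).trans (Module.AEval'.of t).symm).finrank_eq

theorem exists_equiv_blockModule_of_pow_eq_one [Finite V] (hf : Pairwise (Function.onFun IsCoprime f))
    (h : X ^ a - 1 ∣ ∏ i, f i) {t : Module.End F V} (ht : t ^ a = 1) :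
    ∃ m : ι → ℕ, Nonempty (BlockModule f m ≃ₗ[F[X]] Module.AEval' t) := by
  classical
  have : Finite (Module.AEval' t) := ‹Finite V›
  refine exists_equiv_blockModule hf (fun i => (hirr i).out) ?_
  intro x
  obtain ⟨c, hc⟩ := h
  obtain ⟨v, rfl⟩ := (Module.AEval'.of t).surjective x
  rw [hc, mul_comm, mul_smul, sub_smul, Module.AEval'.X_pow_smul_of, ht]
  simp

theorem finite_multiplicities (n : ℕ) (c : F) :
    Finite {m : ι → ℕ // ∑ i, (f i).natDegree * m i = n ∧
      ∏ i, (Algebra.norm F (AdjoinRoot.root (f i))) ^ m i = c} := by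
  classical
  refine Set.Finite.to_subtype
    ((Set.finite_Iic (fun _ : ι => n)).subset ?_)
  rintro m ⟨rfl, -⟩ i
  refine le_trans ?_ (Finset.single_le_sum (fun i _ => Nat.zero_le _) (Finset.mem_univ i))
  exact Nat.le_mul_of_pos_left _ (hirr i).out.natDegree_pos

variable [Finite F]

theorem natCard_end_pow_eq_one [Module.Finite F V] (hf : Pairwise (Function.onFun IsCoprime f))
    (h : X ^ a - 1 ∣ ∏ i, f i) (h' : ∏ i, f i ∣ X ^ a - 1) (c : F) :
    (Nat.card {t : Module.End F V // t ^ a = 1 ∧ LinearMap.det t = c} : ℝ) =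
      ∑' m : {m : ι → ℕ // ∑ i, (f i).natDegree * m i = Module.finrank F V ∧
        ∏ i, (Algebra.norm F (AdjoinRoot.root (f i))) ^ m i = c},
        (Nat.card (V ≃ₗ[F] V) : ℝ) /
          ∏ i, (Nat.card (GL (Fin (m.1 i)) (F[X] ⧸ Ideal.span {f i})) : ℝ) := by
  classical
  have : Finite V := Module.finite_of_finite F
  have := finite_multiplicities (f := f) (Module.finrank F V) c
  have hfin : ∀ i, Finite (F[X] ⧸ Ideal.span {f i}) := fun i => Module.finite_of_finite F
  have hnt : ∀ i, Nontrivial (F[X] ⧸ Ideal.span {f i}) := fun i =>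
    inferInstanceAs (Nontrivial (AdjoinRoot (f i)))
  have : Finite (Module.End F V) := DFunLike.finite _
  have hex := fun (t : {t : Module.End F V // t ^ a = 1 ∧ LinearMap.det t = c}) =>
    exists_equiv_blockModule_of_pow_eq_one hf h t.2.1
  choose μ hμ using hex
  let Φ : {t : Module.End F V // t ^ a = 1 ∧ LinearMap.det t = c} →
      {m : ι → ℕ // ∑ i, (f i).natDegree * m i = Module.finrank F V ∧
        ∏ i, (Algebra.norm F (AdjoinRoot.root (f i))) ^ m i = c} := fun t =>
    ⟨μ t, finrank_of_equiv_blockModule (hμ t).some,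
      (det_of_equiv_blockModule (hμ t).some).symm.trans t.2.2⟩
  have := Fintype.ofFinite {m : ι → ℕ // ∑ i, (f i).natDegree * m i = Module.finrank F V ∧
        ∏ i, (Algebra.norm F (AdjoinRoot.root (f i))) ^ m i = c}
  rw [← Nat.card_congr (Equiv.sigmaFiberEquiv Φ), Nat.card_sigma, tsum_fintype, Nat.cast_sum]
  refine Finset.sum_congr rfl fun m _ => ?_
  obtain ⟨m, hm1, hm2⟩ := m
  let e : {t // Φ t = ⟨m, hm1, hm2⟩} ≃
      {t : Module.End F V // Nonempty (BlockModule f m ≃ₗ[F[X]] Module.AEval' t)} :=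
    { toFun := fun t => ⟨t.1.1, by
        have h1 := congrArg Subtype.val t.2
        have h2 := hμ t.1
        simp only [Φ] at h1
        rwa [h1] at h2⟩
      invFun := fun t => ⟨⟨t.1, pow_eq_one_of_equiv_blockModule h' t.2.some,
          (det_of_equiv_blockModule t.2.some).trans hm2⟩, by
        apply Subtype.ext
        exact blockModule_equiv_unique hf ((hμ _).some.trans t.2.some.symm)⟩
      left_inv := fun t => rfl
      right_inv := fun t => rfl }
  have hVN : Nonempty (BlockModule f m ≃ₗ[F] V) :=
    ⟨LinearEquiv.ofFinrankEq _ _ ((finrank_blockModule m).trans hm1)⟩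
  rw [Nat.card_congr e, ← natCard_end_mul_natCard_aut hVN, natCard_linearEquiv_blockModule hf]
  push_cast
  rw [mul_div_assoc, div_self, mul_one]
  refine Finset.prod_ne_zero_iff.mpr fun i _ => ?_
  exact_mod_cast Nat.card_pos.ne'

theorem natCard_GL_pow_eq_one (hf : Pairwise (Function.onFun IsCoprime f)) (ha : a ≠ 0)
    (h : X ^ a - 1 ∣ ∏ i, f i) (h' : ∏ i, f i ∣ X ^ a - 1) (n : ℕ) (c : F) :
    (Nat.card {t : GL (Fin n) F // t ^ a = 1 ∧ (t : Matrix (Fin n) (Fin n) F).det = c} : ℝ) =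
      ∑' m : {m : ι → ℕ // ∑ i, (f i).natDegree * m i = n ∧
        ∏ i, (Algebra.norm F (AdjoinRoot.root (f i))) ^ m i = c},
        (Nat.card (GL (Fin n) F) : ℝ) /
          ∏ i, (Nat.card (GL (Fin (m.1 i)) (F[X] ⧸ Ideal.span {f i})) : ℝ) := by
  have key := natCard_end_pow_eq_one (V := Fin n → F) hf h h' c
  rw [Module.finrank_fin_fun] at key
  rw [Nat.card_congr ((LinearMap.GeneralLinearGroup.generalLinearEquiv F (Fin n → F)).symm.trans
    (Matrix.GeneralLinearGroup.toLin (n := Fin n) (R := F)).symm).toEquiv] at key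
  rw [← key]
  norm_cast
  refine Nat.card_congr
    { toFun := fun t => ⟨Matrix.toLin' t.1.1, ?_, ?_⟩
      invFun := fun t =>
        ⟨⟨LinearMap.toMatrix' t.1, LinearMap.toMatrix' (t.1 ^ (a - 1)), ?_, ?_⟩, ?_, ?_⟩
      left_inv := ?_
      right_inv := ?_ }
  · rw [← Matrix.toLin'_pow, ← Units.val_pow_eq_pow_val, t.2.1]
    exact Matrix.toLin'_one
  · rw [LinearMap.det_toLin', t.2.2]
  · rw [← LinearMap.toMatrix'_mul, mul_pow_sub_one ha, t.2.1, LinearMap.toMatrix'_one]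
  · rw [← LinearMap.toMatrix'_mul, pow_sub_one_mul ha, t.2.1, LinearMap.toMatrix'_one]
  · ext1
    rw [Units.val_pow_eq_pow_val]
    apply Matrix.toLin'.injective
    rw [Matrix.toLin'_pow, Matrix.toLin'_toMatrix', t.2.1]
    exact Matrix.toLin'_one.symm
  · rw [LinearMap.det_toMatrix', t.2.2]
  · intro t
    ext1
    ext1
    simp
  · intro t
    ext1
    simp

end Count

section Orbits

open Polynomial

variable {F L : Type*} [Field F] [Fintype F] [Field L] [Algebra F L] {a q : ℕ} [NeZero a] {z : L}

omit [NeZero a] in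
theorem IsPrimitiveRoot.pow_val_natCast (hz : IsPrimitiveRoot z a) (k : ℕ) :
    z ^ (k : ZMod a).val = z ^ k := by
  rw [ZMod.val_natCast, hz.eq_orderOf, pow_mod_orderOf]

theorem IsPrimitiveRoot.pow_val_inj (hz : IsPrimitiveRoot z a) {i j : ZMod a} :
    z ^ i.val = z ^ j.val ↔ i = j :=
  ⟨fun h => ZMod.val_injective a (hz.pow_inj i.val_lt j.val_lt h), fun h => h ▸ rfl⟩

theorem IsPrimitiveRoot.pow_val_mul (hz : IsPrimitiveRoot z a) (i : ZMod a) (k : ℕ) :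
    z ^ ((k : ZMod a) * i).val = (z ^ i.val) ^ k := by
  rw [← pow_mul, ← hz.pow_val_natCast (i.val * k)]
  congr 2
  push_cast
  rw [ZMod.natCast_zmod_val, mul_comm]

theorem IsPrimitiveRoot.pow_val_add (hz : IsPrimitiveRoot z a) (i j : ZMod a) :
    z ^ (i + j).val = z ^ i.val * z ^ j.val := by
  rw [← pow_add, ← hz.pow_val_natCast (i.val + j.val)]
  congr 2
  push_cast
  rw [ZMod.natCast_zmod_val, ZMod.natCast_zmod_val]

theorem IsPrimitiveRoot.pow_val_sum (hz : IsPrimitiveRoot z a) {κ : Type*} (s : Finset κ)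
    (g : κ → ZMod a) : z ^ (∑ k ∈ s, g k).val = ∏ k ∈ s, z ^ (g k).val := by
  classical
  induction s using Finset.induction_on with
  | empty => simp
  | insert x s hx ih => rw [Finset.sum_insert hx, Finset.prod_insert hx, hz.pow_val_add, ih]

omit [Fintype F] in
theorem IsPrimitiveRoot.isIntegral_pow_val (hz : IsPrimitiveRoot z a) (i : ZMod a) :
    IsIntegral F (z ^ i.val) :=
  (IsIntegral.of_pow (NeZero.pos a) (by rw [hz.pow_eq_one]; exact isIntegral_one)).pow _

theorem natDegree_minpoly_dvd_iff (hz : IsPrimitiveRoot z a) (hq : Fintype.card F = q)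
    (s : ZMod a) (d : ℕ) :
    (minpoly F (z ^ s.val)).natDegree ∣ d ↔ (q : ZMod a) ^ d * s = s := by
  rw [(minpoly.irreducible (hz.isIntegral_pow_val s)).natDegree_dvd_iff_dvd_X_pow_card_pow_sub_X,
    minpoly.dvd_iff, Nat.card_eq_fintype_card, hq, map_sub, map_pow, aeval_X, sub_eq_zero,
    ← hz.pow_val_mul, hz.pow_val_inj, Nat.cast_pow]

/-- The orbit of `s` is enumerated by the first powers of `q`. -/
noncomputable def orbitEquiv (hz : IsPrimitiveRoot z a) (hq : Fintype.card F = q)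
    (hqa : q.Coprime a) (s : ZMod a) :
    Fin (minpoly F (z ^ s.val)).natDegree ≃ {x : ZMod a // ∃ e : ℕ, (q : ZMod a) ^ e * s = x} := by
  refine Equiv.ofBijective (fun e => ⟨(q : ZMod a) ^ (e : ℕ) * s, e, rfl⟩) ⟨?_, ?_⟩
  · have key : ∀ e e' : ℕ, e ≤ e' → (q : ZMod a) ^ e * s = (q : ZMod a) ^ e' * s →
        (minpoly F (z ^ s.val)).natDegree ∣ e' - e := by
      intro e e' hle h
      rw [natDegree_minpoly_dvd_iff hz hq]
      have hu : IsUnit ((q : ZMod a) ^ e) := ((ZMod.isUnit_iff_coprime q a).mpr hqa).pow e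
      apply hu.mul_left_cancel
      rw [← mul_assoc, ← pow_add, Nat.add_sub_cancel' hle, h]
    intro e e' h
    have h' := congrArg Subtype.val h
    simp only at h'
    rcases le_total e.1 e'.1 with hle | hle
    · have := Nat.eq_zero_of_dvd_of_lt (key _ _ hle h') (by omega)
      ext
      omega
    · have := Nat.eq_zero_of_dvd_of_lt (key _ _ hle h'.symm) (by omega)
      ext
      omega
  · rintro ⟨x, e, rfl⟩
    have hpos := minpoly.natDegree_pos (hz.isIntegral_pow_val (F := F) s)
    refine ⟨⟨e % _, Nat.mod_lt _ hpos⟩, Subtype.ext ?_⟩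
    have h := (natDegree_minpoly_dvd_iff hz hq s _).mp
      (Dvd.intro (e / (minpoly F (z ^ s.val)).natDegree) rfl)
    calc (q : ZMod a) ^ (e % (minpoly F (z ^ s.val)).natDegree) * s
        = (q : ZMod a) ^ (e % (minpoly F (z ^ s.val)).natDegree) * ((q : ZMod a) ^
            ((minpoly F (z ^ s.val)).natDegree * (e / (minpoly F (z ^ s.val)).natDegree)) * s) := by
          rw [h]
      _ = (q : ZMod a) ^ e * s := by rw [← mul_assoc, ← pow_add, Nat.mod_add_div]

theorem orbitSize_eq_natDegree (hz : IsPrimitiveRoot z a) (hq : Fintype.card F = q)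
    (hqa : q.Coprime a) (s : ZMod a) :
    orbitSize a q s = (minpoly F (z ^ s.val)).natDegree := by
  rw [orbitSize, ← Nat.card_congr (orbitEquiv hz hq hqa s), Nat.card_fin]

theorem algebraMap_norm_root_minpoly (hz : IsPrimitiveRoot z a) (hq : Fintype.card F = q)
    (hqa : q.Coprime a) (s : ZMod a) :
    algebraMap F L (Algebra.norm F (AdjoinRoot.root (minpoly F (z ^ s.val)))) =
      z ^ (∑ᶠ x : {x : ZMod a // ∃ e : ℕ, (q : ZMod a) ^ e * s = x}, x.1).val := by
  have hirr := minpoly.irreducible (hz.isIntegral_pow_val (F := F) s)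
  have : Fact (Irreducible (minpoly F (z ^ s.val))) := ⟨hirr⟩
  have : Module.Finite F (AdjoinRoot (minpoly F (z ^ s.val))) :=
    (AdjoinRoot.powerBasis hirr.ne_zero).finite
  have : Finite (AdjoinRoot (minpoly F (z ^ s.val))) := Module.finite_of_finite F
  let φ : AdjoinRoot (minpoly F (z ^ s.val)) →ₐ[F] L :=
    AdjoinRoot.liftAlgHom _ (Algebra.ofId F L) (z ^ s.val) (minpoly.aeval F _)
  have h := congrArg φ (FiniteField.algebraMap_norm_eq_prod_pow F _
    (AdjoinRoot.root (minpoly F (z ^ s.val))))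
  have hφ : φ (AdjoinRoot.root (minpoly F (z ^ s.val))) = z ^ s.val :=
    AdjoinRoot.liftAlgHom_root ..
  rw [AlgHom.commutes, map_prod] at h
  rw [h, ← finsum_comp_equiv (orbitEquiv hz hq hqa s), finsum_eq_sum_of_fintype, hz.pow_val_sum,
    Finset.prod_range, show Module.finrank F (AdjoinRoot (minpoly F (z ^ s.val))) =
      (minpoly F (z ^ s.val)).natDegree from finrank_quotient_span_eq_natDegree]
  refine Finset.prod_congr rfl fun e _ => ?_
  rw [map_pow, hφ, Nat.card_eq_fintype_card, hq, ← hz.pow_val_mul]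
  rw [Nat.cast_pow]
  rfl

variable {T : Finset (ZMod a)}

theorem aeval_minpoly_pow_val (hz : IsPrimitiveRoot z a) (hq : Fintype.card F = q) (s : ZMod a)
    (e : ℕ) : aeval (z ^ ((q : ZMod a) ^ e * s).val) (minpoly F (z ^ s.val)) = 0 := by
  induction e with
  | zero => simp
  | succ e ih =>
    have h := congrArg (aeval (z ^ ((q : ZMod a) ^ e * s).val))
      (FiniteField.expand_card (minpoly F (z ^ s.val)))
    rw [expand_aeval, map_pow, ih, zero_pow Fintype.card_ne_zero, hq, ← hz.pow_val_mul,
      ← mul_assoc, ← pow_succ'] at h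
    exact h

theorem exists_pow_mul_eq_of_aeval_minpoly (hz : IsPrimitiveRoot z a) (hq : Fintype.card F = q)
    (hqa : q.Coprime a) {s t : ZMod a} (h : aeval (z ^ t.val) (minpoly F (z ^ s.val)) = 0) :
    ∃ e : ℕ, (q : ZMod a) ^ e * s = t := by
  classical
  have hne : (minpoly F (z ^ s.val)).map (algebraMap F L) ≠ 0 :=
    Polynomial.map_ne_zero (minpoly.ne_zero (hz.isIntegral_pow_val s))
  by_contra hcon
  let V : Finset (ZMod a) := {x | ∃ e : ℕ, (q : ZMod a) ^ e * s = x}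
  have hV : V.card = (minpoly F (z ^ s.val)).natDegree := by
    rw [← orbitSize_eq_natDegree hz hq hqa, orbitSize, Nat.card_eq_fintype_card,
      Fintype.card_subtype]
  have hsub : (insert t V).image (fun x => z ^ x.val) ⊆
      ((minpoly F (z ^ s.val)).map (algebraMap F L)).roots.toFinset := by
    intro y hy
    obtain ⟨x, hx, rfl⟩ := Finset.mem_image.mp hy
    rw [Multiset.mem_toFinset, mem_roots hne, IsRoot, eval_map_algebraMap]
    rcases Finset.mem_insert.mp hx with rfl | hx
    · exact h
    · obtain ⟨e, rfl⟩ := (Finset.mem_filter.mp hx).2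
      exact aeval_minpoly_pow_val hz hq s e
  have h1 := (Finset.card_le_card hsub).trans ((Multiset.toFinset_card_le _).trans
    ((card_roots' _).trans natDegree_map_le))
  rw [Finset.card_image_of_injective _ fun i j hij => hz.pow_val_inj.mp hij,
    Finset.card_insert_of_notMem (by simpa [V] using hcon), hV] at h1
  omega

theorem minpoly_pairwise_coprime (hz : IsPrimitiveRoot z a) (hq : Fintype.card F = q)
    (hqa : q.Coprime a) (hT : IsOrbitRepSet a q T) :
    Pairwise (Function.onFun IsCoprime fun s : T => minpoly F (z ^ (s : ZMod a).val)) := by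
  intro s t hst
  have hs := hz.isIntegral_pow_val (F := F) s.1
  have ht := hz.isIntegral_pow_val (F := F) t.1
  refine (EuclideanDomain.dvd_or_coprime _ _ (minpoly.irreducible hs)).resolve_left fun h => hst ?_
  rw [minpoly.dvd_iff] at h
  exact Subtype.ext ((hT s).unique ⟨s.2, 0, by simp⟩
    ⟨t.2, exists_pow_mul_eq_of_aeval_minpoly hz hq hqa h⟩)

theorem prod_minpoly_dvd (hz : IsPrimitiveRoot z a) (hq : Fintype.card F = q)
    (hqa : q.Coprime a) (hT : IsOrbitRepSet a q T) :
    ∏ s : T, minpoly F (z ^ (s : ZMod a).val) ∣ X ^ a - 1 := by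
  refine Finset.prod_dvd_of_coprime
    (fun s _ t _ hst => minpoly_pairwise_coprime hz hq hqa hT hst) fun s _ => ?_
  rw [minpoly.dvd_iff]
  rw [map_sub, map_pow, map_one, aeval_X, ← pow_mul, mul_comm, pow_mul, hz.pow_eq_one, one_pow,
    sub_self]

theorem dvd_prod_minpoly (hz : IsPrimitiveRoot z a) (hq : Fintype.card F = q)
    (hT : IsOrbitRepSet a q T) :
    X ^ a - 1 ∣ ∏ s : T, minpoly F (z ^ (s : ZMod a).val) := by
  rw [← Polynomial.map_dvd_map' (algebraMap F L), Polynomial.map_sub, Polynomial.map_pow, map_X,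
    Polynomial.map_one, X_pow_sub_one_eq_prod (NeZero.pos a) hz]
  refine Finset.prod_dvd_of_coprime
    (fun s _ t _ hst => pairwise_coprime_X_sub_C Function.injective_id hst) fun x hx => ?_
  obtain ⟨k, -, rfl⟩ := hz.eq_pow_of_pow_eq_one ((mem_nthRootsFinset (NeZero.pos a) _).mp hx)
  obtain ⟨s, ⟨hs, e, he⟩, -⟩ := hT (k : ZMod a)
  rw [dvd_iff_isRoot, IsRoot, Polynomial.map_prod, eval_prod, Finset.prod_eq_zero_iff]
  refine ⟨⟨s, hs⟩, Finset.mem_univ _, ?_⟩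
  rw [eval_map_algebraMap, ← hz.pow_val_natCast, ← he]
  exact aeval_minpoly_pow_val hz hq s e

end Orbits

section Extend

variable {a q : ℕ} {T : Finset (ZMod a)}

/-- The representative in `T` of the orbit of `i`. -/
noncomputable def orbitRep (hT : IsOrbitRepSet a q T) (i : ZMod a) : T :=
  ⟨(hT i).choose, (hT i).choose_spec.1.1⟩

theorem exists_pow_mul_orbitRep (hT : IsOrbitRepSet a q T) (i : ZMod a) :
    ∃ e : ℕ, (q : ZMod a) ^ e * orbitRep hT i = i :=
  (hT i).choose_spec.1.2

theorem orbitRep_pow_mul (hT : IsOrbitRepSet a q T) (s : T) (e : ℕ) :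
    orbitRep hT ((q : ZMod a) ^ e * s) = s :=
  Subtype.ext ((hT _).unique ⟨(orbitRep hT _).2, exists_pow_mul_orbitRep hT _⟩ ⟨s.2, e, rfl⟩)

theorem orbitRep_coe (hT : IsOrbitRepSet a q T) (s : T) : orbitRep hT s = s := by
  simpa using orbitRep_pow_mul hT s 0

theorem orbitRep_mul (hT : IsOrbitRepSet a q T) (i : ZMod a) :
    orbitRep hT ((q : ZMod a) * i) = orbitRep hT i := by
  obtain ⟨e, he⟩ := exists_pow_mul_orbitRep hT i
  conv_lhs => rw [← he, ← mul_assoc, ← pow_succ', orbitRep_pow_mul]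

theorem eq_apply_orbitRep (hT : IsOrbitRepSet a q T) {β : Type*} {m : ZMod a → β}
    (hm : ∀ i, m ((q : ZMod a) * i) = m i) (i : ZMod a) : m i = m (orbitRep hT i) := by
  have key : ∀ (e : ℕ) (s : ZMod a), m ((q : ZMod a) ^ e * s) = m s := by
    intro e s
    induction e with
    | zero => simp
    | succ e ih => rw [pow_succ', mul_assoc, hm, ih]
  obtain ⟨e, he⟩ := exists_pow_mul_orbitRep hT i
  rw [← key e (orbitRep hT i), he]

variable [NeZero a]

theorem sum_eq_sum_finsum_orbit (hT : IsOrbitRepSet a q T) {M : Type*} [AddCommMonoid M]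
    (g : ZMod a → M) :
    ∑ᶠ i, g i = ∑ s : T, ∑ᶠ x : {x : ZMod a // ∃ e : ℕ, (q : ZMod a) ^ e * s = x}, g x := by
  classical
  simp_rw [finsum_eq_sum_of_fintype]
  rw [← Fintype.sum_sigma' (fun (s : T) (x : {x : ZMod a // ∃ e : ℕ, (q : ZMod a) ^ e * s = x}) =>
    g x)]
  symm
  refine Fintype.sum_bijective (fun p => p.2.1) ⟨?_, fun i => ?_⟩ _ _ fun _ => rfl
  · rintro ⟨s, x, e, rfl⟩ ⟨t, y, e', rfl⟩ h
    obtain rfl : s = t := by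
      rw [← orbitRep_pow_mul hT s e, ← orbitRep_pow_mul hT t e']
      exact congrArg _ h
    simp only at h
    simp only [h]
  · exact ⟨⟨orbitRep hT i, i, exists_pow_mul_orbitRep hT i⟩, rfl⟩

theorem sum_orbitSize_mul (hT : IsOrbitRepSet a q T) {R : Type*} [Semiring R] (g : T → R) :
    ∑ᶠ i, g (orbitRep hT i) = ∑ s : T, (orbitSize a q s : R) * g s := by
  classical
  rw [sum_eq_sum_finsum_orbit hT]
  refine Finset.sum_congr rfl fun s _ => ?_
  rw [finsum_congr (g := fun _ => g s)
    (by rintro ⟨_, e, rfl⟩; exact congrArg g (orbitRep_pow_mul hT s e)),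
    finsum_eq_sum_of_fintype, Finset.sum_const, Finset.card_univ, nsmul_eq_mul, orbitSize,
    Nat.card_eq_fintype_card]

theorem sum_orbit_mul (hT : IsOrbitRepSet a q T) (g : T → ZMod a) :
    ∑ᶠ i, i * g (orbitRep hT i) =
      ∑ s : T, g s * ∑ᶠ x : {x : ZMod a // ∃ e : ℕ, (q : ZMod a) ^ e * s = x}, x.1 := by
  classical
  rw [sum_eq_sum_finsum_orbit hT]
  refine Finset.sum_congr rfl fun s _ => ?_
  simp_rw [finsum_eq_sum_of_fintype, Finset.mul_sum]
  refine Finset.sum_congr rfl ?_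
  rintro ⟨_, e, rfl⟩ -
  rw [orbitRep_pow_mul, mul_comm]

end Extend

section CardGL

/-- The finite product `∏_{j = 1}^m (1 - Q⁻ʲ)`. -/
noncomputable def qPoch (Q : ℝ) (m : ℕ) : ℝ :=
  ∏ j ∈ Finset.range m, (1 - (Q⁻¹) ^ (j + 1))

theorem natCard_GL_eq_qPoch {K : Type*} [Field K] [Finite K] {Q : ℕ} (hQ : Nat.card K = Q)
    (m : ℕ) : (Nat.card (GL (Fin m) K) : ℝ) = (Q : ℝ) ^ (m ^ 2) * qPoch Q m := by
  have := Fintype.ofFinite K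
  have hQ1 : 1 < Q := hQ ▸ Finite.one_lt_card
  have hQ0 : (Q : ℝ) ≠ 0 := by positivity
  rw [Matrix.card_GL_field, ← Nat.card_eq_fintype_card, hQ, Nat.cast_prod,
    ← Finset.prod_range (fun i => ((Q ^ m - Q ^ i : ℕ) : ℝ)), sq, pow_mul, qPoch,
    ← Finset.prod_range_reflect (fun j => 1 - (Q : ℝ)⁻¹ ^ (j + 1)),
    Finset.pow_eq_prod_const ((Q : ℝ) ^ m) m, ← Finset.prod_mul_distrib]
  refine Finset.prod_congr rfl fun i hi => ?_
  have hi' : i < m := Finset.mem_range.mp hi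
  obtain ⟨k, rfl⟩ := Nat.exists_eq_add_of_lt hi'
  rw [Nat.cast_sub (Nat.pow_le_pow_right hQ1.le hi'.le),
    show i + k + 1 - 1 - i + 1 = k + 1 by omega]
  push_cast
  rw [mul_sub, mul_one, inv_pow, add_assoc, pow_add, mul_assoc, mul_inv_cancel₀ (by positivity),
    mul_one]

end CardGL

section Count

open Polynomial

variable {F L : Type*} [Field F] [Fintype F] [Field L] [Algebra F L] {a q : ℕ} [NeZero a] {z : L}
  {T : Finset (ZMod a)}

theorem natCard_quotient_minpoly (hz : IsPrimitiveRoot z a) (hq : Fintype.card F = q)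
    (hqa : q.Coprime a) (s : ZMod a) :
    Nat.card (F[X] ⧸ Ideal.span {minpoly F (z ^ s.val)}) = q ^ orbitSize a q s := by
  have : Fact (Irreducible (minpoly F (z ^ s.val))) := ⟨minpoly.irreducible (hz.isIntegral_pow_val s)⟩
  have : Module.Finite F (F[X] ⧸ Ideal.span {minpoly F (z ^ s.val)}) :=
    finite_quotient_span_irreducible (f := fun _ : Unit => minpoly F (z ^ s.val)) ()
  rw [orbitSize_eq_natDegree hz hq hqa, Module.natCard_eq_pow_finrank (K := F),
    finrank_quotient_span_eq_natDegree, Nat.card_eq_fintype_card, hq]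

theorem natCard_eq_tsum_div (hz : IsPrimitiveRoot z a) (hq : Fintype.card F = q)
    (hqa : q.Coprime a) (hT : IsOrbitRepSet a q T) (n : ℕ) (k : ZMod a) :
    (Nat.card {t : GL (Fin n) F // t ^ a = 1 ∧
        algebraMap F L (t : Matrix (Fin n) (Fin n) F).det = z ^ k.val} : ℝ) =
      ∑' m : {m : T → ℕ // ∑ s : T, orbitSize a q s * m s = n ∧
          ∑ᶠ i, i * (m (orbitRep hT i) : ZMod a) = k},
        (q : ℝ) ^ (n ^ 2) * qPoch q n /
          ∏ s : T, ((q : ℝ) ^ orbitSize a q s) ^ (m.1 s ^ 2) * qPoch (q ^ orbitSize a q s) (m.1 s) := by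
  have hirr : ∀ s : T, Fact (Irreducible (minpoly F (z ^ (s : ZMod a).val))) :=
    fun s => ⟨minpoly.irreducible (hz.isIntegral_pow_val _)⟩
  have hnorm : ∀ m : T → ℕ, algebraMap F L (∏ s : T, Algebra.norm F
      (AdjoinRoot.root (minpoly F (z ^ (s : ZMod a).val))) ^ m s) =
      z ^ (∑ᶠ i, i * (m (orbitRep hT i) : ZMod a)).val := by
    intro m
    rw [sum_orbit_mul hT fun s => (m s : ZMod a), hz.pow_val_sum, map_prod]
    refine Finset.prod_congr rfl fun s _ => ?_
    rw [map_pow, algebraMap_norm_root_minpoly hz hq hqa, hz.pow_val_mul]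
  by_cases hc : ∃ c : F, algebraMap F L c = z ^ k.val
  · obtain ⟨c, hc⟩ := hc
    simp_rw [← hc, (algebraMap F L).injective.eq_iff]
    rw [natCard_GL_pow_eq_one (minpoly_pairwise_coprime hz hq hqa hT) (NeZero.ne a)
      (dvd_prod_minpoly hz hq hT) (prod_minpoly_dvd hz hq hqa hT)]
    have hiff : ∀ m : T → ℕ, (∑ s : T, orbitSize a q s * m s = n ∧
          ∑ᶠ i, i * (m (orbitRep hT i) : ZMod a) = k) ↔
        (∑ s : T, (minpoly F (z ^ (s : ZMod a).val)).natDegree * m s = n ∧ ∏ s : T, Algebra.norm F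
          (AdjoinRoot.root (minpoly F (z ^ (s : ZMod a).val))) ^ m s = c) := fun m => by
      rw [← (algebraMap F L).injective.eq_iff (b := c), hnorm, hc, hz.pow_val_inj]
      simp_rw [orbitSize_eq_natDegree hz hq hqa]
    refine ((Equiv.subtypeEquivRight hiff).tsum_eq _).symm.trans (tsum_congr fun m => ?_)
    rw [natCard_GL_eq_qPoch (by rw [Nat.card_eq_fintype_card, hq])]
    congr 1
    refine Finset.prod_congr rfl fun s _ => ?_
    let _ : Field (F[X] ⧸ Ideal.span {minpoly F (z ^ (s : ZMod a).val)}) :=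
      AdjoinRoot.instField
    have hcard := natCard_quotient_minpoly hz hq hqa s.1
    have : Finite (F[X] ⧸ Ideal.span {minpoly F (z ^ (s : ZMod a).val)}) :=
      Nat.finite_of_card_ne_zero (by
        rw [hcard]; exact pow_ne_zero _ (hq ▸ Fintype.card_ne_zero))
    rw [← Nat.cast_pow q]
    exact natCard_GL_eq_qPoch hcard (m.1 s)
  · have h1 : IsEmpty {t : GL (Fin n) F // t ^ a = 1 ∧
        algebraMap F L (t : Matrix (Fin n) (Fin n) F).det = z ^ k.val} :=
      ⟨fun t => hc ⟨_, t.2.2⟩⟩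
    have h2 : IsEmpty {m : T → ℕ // ∑ s : T, orbitSize a q s * m s = n ∧
          ∑ᶠ i, i * (m (orbitRep hT i) : ZMod a) = k} :=
      ⟨fun m => hc ⟨_, (hnorm m.1).trans (by rw [m.2.2])⟩⟩
    rw [Nat.card_of_isEmpty, tsum_empty, Nat.cast_zero]

end Count

section Multiplicities

variable {F L : Type*} [Field F] [Fintype F] [Field L] [Algebra F L] {a q : ℕ} [NeZero a] {z : L}
  {T : Finset (ZMod a)}

/-- The multiplicity functions over which `Cconst` sums. -/
abbrev MultFn (a q n : ℕ) (k : ZMod a) : Type :=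
  {m : ZMod a → ℤ //
    (∀ i, m ((q : ZMod a) * i) = m i) ∧ (∑ᶠ i, m i) = (n : ℤ) ∧
      (∑ᶠ i : ZMod a, i * (m i : ZMod a)) = k}

/-- The squared distance of a multiplicity function to the constant function `n / a`. -/
noncomputable def energy (a n : ℕ) (m : ZMod a → ℤ) : ℝ :=
  ∑ᶠ i : ZMod a, ((m i : ℝ) - (n : ℝ) / (a : ℝ)) ^ 2

/-- The ratio of finite products attached to a multiplicity function. -/
noncomputable def multWeight (q n : ℕ) (T : Finset (ZMod a)) (m : ZMod a → ℤ) : ℝ :=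
  if ∀ i, 0 ≤ m i then
    qPoch q n / ∏ s : T, qPoch ((q : ℝ) ^ orbitSize a q s) (m s).toNat
  else 0

theorem energy_eq {n : ℕ} {m : ZMod a → ℤ} (hm : ∑ᶠ i, m i = (n : ℤ)) :
    energy a n m = ∑ᶠ i, (m i : ℝ) ^ 2 - (n : ℝ) ^ 2 / a := by
  have ha : (a : ℝ) ≠ 0 := NeZero.ne _
  rw [finsum_eq_sum_of_fintype] at hm
  have hm' : ∑ i, (m i : ℝ) = n := by exact_mod_cast hm
  rw [energy, finsum_eq_sum_of_fintype, finsum_eq_sum_of_fintype]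
  simp_rw [sub_sq]
  rw [Finset.sum_add_distrib, Finset.sum_sub_distrib, Finset.sum_const, ← Finset.sum_mul,
    ← Finset.mul_sum, hm', Finset.card_univ, ZMod.card, nsmul_eq_mul]
  field_simp
  ring

theorem natCard_mul_rpow_eq_tsum (hz : IsPrimitiveRoot z a) (hq : Fintype.card F = q)
    (hqa : q.Coprime a) (hT : IsOrbitRepSet a q T) (n : ℕ) (k : ZMod a) :
    (Nat.card {t : GL (Fin n) F // t ^ a = 1 ∧
        algebraMap F L (t : Matrix (Fin n) (Fin n) F).det = z ^ k.val} : ℝ) *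
        (q : ℝ) ^ (-((1 - 1 / (a : ℝ)) * (n : ℝ) ^ 2)) =
      ∑' m : MultFn a q n k, (q : ℝ) ^ (-energy a n m.1) * multWeight q n T m.1 := by
  classical
  have hq0 : (0 : ℝ) < q := by rw [← hq]; exact_mod_cast Fintype.card_pos
  let g : {m : T → ℕ // ∑ s : T, orbitSize a q s * m s = n ∧
      ∑ᶠ i, i * (m (orbitRep hT i) : ZMod a) = k} → MultFn a q n k := fun m =>
    ⟨fun i => m.1 (orbitRep hT i), fun i => by simp only [orbitRep_mul], by
      rw [sum_orbitSize_mul hT fun s => (m.1 s : ℤ)]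
      exact_mod_cast m.2.1, by simpa using m.2.2⟩
  have hg : Function.Injective g := by
    intro m m' h
    refine Subtype.ext (funext fun s => ?_)
    have := congrFun (congrArg Subtype.val h) s
    simp only [g, orbitRep_coe] at this
    exact_mod_cast this
  rw [natCard_eq_tsum_div hz hq hqa hT, ← tsum_mul_right, ← hg.tsum_eq]
  · refine tsum_congr fun m => ?_
    have hsq : ∑ᶠ i, (((g m).1 i : ℤ) : ℝ) ^ 2 =
        ∑ s : T, (orbitSize a q s : ℝ) * (m.1 s : ℝ) ^ 2 := by
      rw [← sum_orbitSize_mul hT fun s => (m.1 s : ℝ) ^ 2]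
      simp [g]
    rw [energy_eq (g m).2.2.1, hsq, multWeight, if_pos fun i => Int.natCast_nonneg _]
    simp only [g, orbitRep_coe, Int.toNat_natCast]
    have hprod : ∏ s : T, ((q : ℝ) ^ orbitSize a q s) ^ (m.1 s ^ 2) =
        (q : ℝ) ^ (∑ s : T, (orbitSize a q s : ℝ) * (m.1 s : ℝ) ^ 2) := by
      rw [Real.rpow_sum_of_pos hq0]
      refine Finset.prod_congr rfl fun s _ => ?_
      rw [← pow_mul, ← Real.rpow_natCast]
      push_cast
      rfl
    rw [Finset.prod_mul_distrib, hprod, mul_div_mul_comm, mul_right_comm, ← Real.rpow_natCast,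
      ← Real.rpow_sub hq0, ← Real.rpow_add hq0]
    congr 2
    push_cast
    ring
  · intro m hm
    have h0 : ∀ i, 0 ≤ m.1 i := by
      by_contra h
      exact hm (by simp [multWeight, h])
    have hmi : ∀ i, ((m.1 (orbitRep hT i)).toNat : ℤ) = m.1 i := fun i => by
      rw [Int.toNat_of_nonneg (h0 _), ← eq_apply_orbitRep hT m.2.1]
    refine ⟨⟨fun s => (m.1 s).toNat, ?_, ?_⟩, Subtype.ext (funext hmi)⟩
    · have := sum_orbitSize_mul hT fun s : T => ((m.1 s).toNat : ℤ)
      simp_rw [hmi] at this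
      rw [m.2.2.1] at this
      exact_mod_cast this.symm
    · have : ∀ i, (((m.1 (orbitRep hT i)).toNat : ℕ) : ZMod a) = (m.1 i : ZMod a) := fun i => by
        rw [← hmi i, Int.cast_natCast]
      simp_rw [this]
      exact m.2.2.2

end Multiplicities

section Estimates

open Filter Topology

theorem abs_prod_sub_prod_le {κ : Type*} (s : Finset κ) {x y : κ → ℝ} {B δ : ℝ} (hB : 1 ≤ B)
    (hx : ∀ i ∈ s, |x i| ≤ B) (hy : ∀ i ∈ s, |y i| ≤ B) (hδ : ∀ i ∈ s, |x i - y i| ≤ δ) :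
    |∏ i ∈ s, x i - ∏ i ∈ s, y i| ≤ s.card * B ^ s.card * δ := by
  classical
  induction s using Finset.induction_on with
  | empty => simp
  | insert i s hi ih =>
    have hB0 : 0 ≤ B := by linarith
    have hxi := hx i (Finset.mem_insert_self i s)
    have hδi := hδ i (Finset.mem_insert_self i s)
    have hδ0 : 0 ≤ δ := (abs_nonneg _).trans hδi
    have ih' := ih (fun j hj => hx j (Finset.mem_insert_of_mem hj))
      (fun j hj => hy j (Finset.mem_insert_of_mem hj))
      (fun j hj => hδ j (Finset.mem_insert_of_mem hj))
    have hyp : |∏ j ∈ s, y j| ≤ B ^ s.card := by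
      rw [Finset.abs_prod]
      exact (Finset.prod_le_prod (fun _ _ => abs_nonneg _)
        fun j hj => hy j (Finset.mem_insert_of_mem hj)).trans_eq (Finset.prod_const _)
    rw [Finset.prod_insert hi, Finset.prod_insert hi, Finset.card_insert_of_notMem hi,
      show x i * ∏ j ∈ s, x j - y i * ∏ j ∈ s, y j =
        x i * (∏ j ∈ s, x j - ∏ j ∈ s, y j) + (x i - y i) * ∏ j ∈ s, y j by ring]
    calc |x i * (∏ j ∈ s, x j - ∏ j ∈ s, y j) + (x i - y i) * ∏ j ∈ s, y j|
        ≤ |x i| * |∏ j ∈ s, x j - ∏ j ∈ s, y j| + |x i - y i| * |∏ j ∈ s, y j| := by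
          rw [← abs_mul, ← abs_mul]
          exact abs_add_le _ _
      _ ≤ B * (s.card * B ^ s.card * δ) + δ * B ^ s.card := by gcongr
      _ ≤ B * (s.card * B ^ s.card * δ) + δ * (B ^ s.card * B) := by
          gcongr
          exact le_mul_of_one_le_right (by positivity) hB
      _ = (s.card + 1 : ℕ) * B ^ (s.card + 1) * δ := by
          push_cast
          ring

theorem inv_pow_le_half_pow {Q : ℝ} (hQ : 2 ≤ Q) (j : ℕ) : (Q⁻¹) ^ j ≤ (1 / 2) ^ j := by
  rw [one_div]
  gcongr

theorem qPoch_succ (Q : ℝ) (m : ℕ) : qPoch Q (m + 1) = qPoch Q m * (1 - (Q⁻¹) ^ (m + 1)) :=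
  Finset.prod_range_succ _ _

theorem quarter_le_qPoch {Q : ℝ} (hQ : 2 ≤ Q) (m : ℕ) : 1 / 4 ≤ qPoch Q m := by
  have key : ∀ k : ℕ, 1 / 4 + (1 / 2 : ℝ) ^ (k + 2) ≤ qPoch Q (k + 1) := by
    intro k
    induction k with
    | zero =>
      have := inv_pow_le_half_pow hQ 1
      norm_num [qPoch] at this ⊢
      linarith
    | succ k ih =>
      rw [qPoch_succ]
      have h1 := inv_pow_le_half_pow hQ (k + 1 + 1)
      have h2 : (1 / 2 : ℝ) ^ (k + 2) ≤ 1 / 4 := by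
        rw [pow_add]
        have : (1 / 2 : ℝ) ^ k ≤ 1 := pow_le_one₀ (by norm_num) (by norm_num)
        linarith
      have h3 : (0 : ℝ) < (1 / 2) ^ (k + 2) := by positivity
      rw [show k + 1 + 2 = k + 2 + 1 by ring, pow_succ]
      rw [show k + 1 + 1 = k + 2 by ring] at h1 ⊢
      generalize (1 / 2 : ℝ) ^ (k + 2) = h at *
      have h4 : (1 / 4 + h) * (1 - h) ≤ qPoch Q (k + 1) * (1 - Q⁻¹ ^ (k + 2)) :=
        mul_le_mul ih (by linarith) (by linarith) (by linarith)
      nlinarith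
  cases m with
  | zero => norm_num [qPoch]
  | succ k => exact le_trans (by linarith [show (0 : ℝ) < (1 / 2) ^ (k + 2) by positivity]) (key k)

theorem qPoch_antitone {Q : ℝ} (hQ : 2 ≤ Q) : Antitone (qPoch Q) := by
  refine antitone_nat_of_succ_le fun m => ?_
  rw [qPoch_succ]
  have : 0 ≤ Q⁻¹ ^ (m + 1) := by positivity
  exact mul_le_of_le_one_right (by linarith [quarter_le_qPoch hQ m]) (by linarith)

theorem qPoch_le_one {Q : ℝ} (hQ : 2 ≤ Q) (m : ℕ) : qPoch Q m ≤ 1 :=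
  (qPoch_antitone hQ (Nat.zero_le m)).trans (by simp [qPoch])

theorem qPoch_sub_le {Q : ℝ} (hQ : 2 ≤ Q) (m k : ℕ) :
    qPoch Q m - qPoch Q (m + k) ≤ (1 / 2) ^ m - (1 / 2) ^ (m + k) := by
  induction k with
  | zero => simp
  | succ k ih =>
    have h1 := inv_pow_le_half_pow hQ (m + k + 1)
    have h2 := qPoch_le_one hQ (m + k)
    have h3 := quarter_le_qPoch hQ (m + k)
    have h4 : 0 ≤ Q⁻¹ ^ (m + k + 1) := by positivity
    have h5 : qPoch Q (m + k) * Q⁻¹ ^ (m + k + 1) ≤ (1 / 2) ^ (m + k + 1) :=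
      (mul_le_of_le_one_left h4 h2).trans h1
    rw [← add_assoc, qPoch_succ]
    rw [pow_succ] at h5 ⊢
    rw [pow_succ] at h5 ⊢
    linarith

/-- The infinite product `∏_{j ≥ 1} (1 - Q⁻ʲ)`. -/
noncomputable def qPochInf (Q : ℝ) : ℝ :=
  ∏' j : ℕ, (1 - (Q⁻¹) ^ (j + 1))

theorem tendsto_qPoch {Q : ℝ} (hQ : 2 ≤ Q) : Tendsto (qPoch Q) atTop (𝓝 (qPochInf Q)) := by
  have hs : Summable fun j : ℕ => -(Q⁻¹) ^ (j + 1) :=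
    ((summable_nat_add_iff 1).mpr (summable_geometric_of_lt_one (by positivity)
      (inv_lt_one_of_one_lt₀ (by linarith)))).neg
  have := (Real.multipliable_one_add_of_summable hs).hasProd.tendsto_prod_nat
  simp only [← sub_eq_add_neg] at this
  exact this

theorem quarter_le_qPochInf {Q : ℝ} (hQ : 2 ≤ Q) : 1 / 4 ≤ qPochInf Q :=
  ge_of_tendsto' (tendsto_qPoch hQ) (quarter_le_qPoch hQ)

theorem qPochInf_le_one {Q : ℝ} (hQ : 2 ≤ Q) : qPochInf Q ≤ 1 :=
  le_of_tendsto' (tendsto_qPoch hQ) (qPoch_le_one hQ)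

theorem abs_qPoch_sub_qPochInf_le {Q : ℝ} (hQ : 2 ≤ Q) (m : ℕ) :
    |qPoch Q m - qPochInf Q| ≤ (1 / 2) ^ m := by
  rw [abs_of_nonneg (sub_nonneg.mpr ((qPoch_antitone hQ).le_of_tendsto (tendsto_qPoch hQ) m))]
  refine le_of_tendsto (tendsto_const_nhds.sub (tendsto_qPoch hQ)) ?_
  filter_upwards [eventually_ge_atTop m] with k hk
  obtain ⟨l, rfl⟩ := Nat.exists_eq_add_of_le hk
  have := qPoch_sub_le hQ m l
  have h : (0 : ℝ) < (1 / 2) ^ (m + l) := by positivity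
  linarith

/-- A bound for the one-dimensional theta series `∑ 2^{-(z - y)² / 2}`, uniform in `y`. -/
theorem exists_sum_rpow_sq_le :
    ∃ θ : ℝ, 1 ≤ θ ∧ ∀ (y : ℝ) (s : Finset ℤ), ∑ z ∈ s, (2 : ℝ) ^ (-((z - y) ^ 2 / 2)) ≤ θ := by
  let g : ℤ → ℝ := fun k => 2 * (2 : ℝ) ^ (-(|(k : ℝ)| / 2))
  have hg0 : ∀ k, 0 ≤ g k := fun k => by positivity
  have hnat : Summable fun n : ℕ => 2 * (2 : ℝ) ^ (-((n : ℝ) / 2)) := by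
    have : ∀ n : ℕ, 2 * (2 : ℝ) ^ (-((n : ℝ) / 2)) = 2 * ((2 : ℝ) ^ (-(1 / 2) : ℝ)) ^ n := by
      intro n
      rw [← Real.rpow_natCast, ← Real.rpow_mul (by norm_num)]
      congr 2
      ring
    simp_rw [this]
    exact (summable_geometric_of_lt_one (by positivity)
      (Real.rpow_lt_one_of_one_lt_of_neg (by norm_num) (by norm_num))).mul_left 2
  have hg : Summable g := by
    refine Summable.of_nat_of_neg ?_ ?_ <;> simpa [g] using hnat
  refine ⟨∑' k, g k + 1, le_add_of_nonneg_left (tsum_nonneg hg0), fun y s => ?_⟩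
  have hle : ∀ z : ℤ, (2 : ℝ) ^ (-((z - y) ^ 2 / 2)) ≤ g (z - ⌊y⌋) := by
    intro z
    have h1 := Int.floor_le y
    have h2 := (Int.lt_floor_add_one y).le
    have h3 : |((z - ⌊y⌋ : ℤ) : ℝ)| ≤ |(z : ℝ) - y| + 1 := by
      push_cast
      have h := abs_add_le ((z : ℝ) - y) (y - ⌊y⌋)
      rw [sub_add_sub_cancel, abs_of_nonneg (sub_nonneg.mpr h1)] at h
      linarith
    have h4 : |(z : ℝ) - y| - 1 / 4 ≤ (z - y) ^ 2 := by
      rw [← sq_abs]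
      nlinarith [sq_nonneg (|(z : ℝ) - y| - 1 / 2)]
    calc (2 : ℝ) ^ (-((z - y) ^ 2 / 2)) ≤ (2 : ℝ) ^ (1 + -(|((z - ⌊y⌋ : ℤ) : ℝ)| / 2)) :=
          Real.rpow_le_rpow_of_exponent_le (by norm_num) (by linarith)
      _ = g (z - ⌊y⌋) := by rw [Real.rpow_add (by norm_num), Real.rpow_one]
  have hs : Summable fun z : ℤ => g (z - ⌊y⌋) :=
    hg.comp_injective (Equiv.subRight ⌊y⌋).injective
  calc ∑ z ∈ s, (2 : ℝ) ^ (-((z - y) ^ 2 / 2)) ≤ ∑ z ∈ s, g (z - ⌊y⌋) :=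
        Finset.sum_le_sum fun z _ => hle z
    _ ≤ ∑' z, g (z - ⌊y⌋) := hs.sum_le_tsum s fun z _ => hg0 _
    _ = ∑' k, g k := (Equiv.subRight ⌊y⌋).tsum_eq g
    _ ≤ ∑' k, g k + 1 := by linarith

theorem exists_sum_pi_rpow_sq_le (ι : Type*) [Fintype ι] :
    ∃ Θ : ℝ, 1 ≤ Θ ∧ ∀ (y : ℝ) (s : Finset (ι → ℤ)),
      ∑ m ∈ s, (2 : ℝ) ^ (-((∑ i, ((m i : ℝ) - y) ^ 2) / 2)) ≤ Θ := by
  classical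
  obtain ⟨θ, hθ1, hθ⟩ := exists_sum_rpow_sq_le
  refine ⟨θ ^ Fintype.card ι, one_le_pow₀ hθ1, fun y s => ?_⟩
  let t : ι → Finset ℤ := fun i => s.image fun m => m i
  have hsub : s ⊆ Fintype.piFinset t := fun m hm =>
    Fintype.mem_piFinset.mpr fun i => Finset.mem_image_of_mem _ hm
  calc ∑ m ∈ s, (2 : ℝ) ^ (-((∑ i, ((m i : ℝ) - y) ^ 2) / 2))
      = ∑ m ∈ s, ∏ i, (2 : ℝ) ^ (-(((m i : ℝ) - y) ^ 2 / 2)) := by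
        refine Finset.sum_congr rfl fun m _ => ?_
        rw [← Real.rpow_sum_of_pos (by norm_num), Finset.sum_neg_distrib, Finset.sum_div]
    _ ≤ ∑ m ∈ Fintype.piFinset t,
          ∏ i, (2 : ℝ) ^ (-(((m i : ℝ) - y) ^ 2 / 2)) :=
        Finset.sum_le_sum_of_subset_of_nonneg hsub fun _ _ _ => by positivity
    _ = ∏ i, ∑ z ∈ t i, (2 : ℝ) ^ (-(((z : ℝ) - y) ^ 2 / 2)) := by
        rw [Finset.prod_univ_sum]
    _ ≤ ∏ _i : ι, θ := Finset.prod_le_prod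
        (fun _ _ => Finset.sum_nonneg fun _ _ => by positivity) fun i _ => hθ y _
    _ = θ ^ Fintype.card ι := by rw [Finset.prod_const, Finset.card_univ]

end Estimates

section Approx

variable {a q : ℕ} [NeZero a] {T : Finset (ZMod a)}

/-- The ratio of infinite products in `Cconst`. -/
noncomputable def multConst (q : ℕ) (T : Finset (ZMod a)) : ℝ :=
  qPochInf q / ∏ s : T, qPochInf ((q : ℝ) ^ orbitSize a q s)

omit [NeZero a] in
theorem Cconst_eq_tsum (hq : 2 ≤ q) (n : ℕ) (k : ZMod a) (T : Finset (ZMod a)) :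
    Cconst a q n k T = ∑' m : MultFn a q n k, (q : ℝ) ^ (-energy a n m.1) * multConst q T := by
  have hq0 : (0 : ℝ) < q := by positivity
  rw [tsum_mul_right, mul_comm, Cconst, multConst, qPochInf, ← Finset.prod_coe_sort]
  simp only [qPochInf, energy]
  congr 2
  · refine tprod_congr fun j => ?_
    rw [Real.rpow_neg hq0.le, inv_pow, ← Real.rpow_natCast]
    push_cast
    rfl
  · refine Finset.prod_congr rfl fun s _ => tprod_congr fun j => ?_
    rw [Real.rpow_neg hq0.le, inv_pow, ← pow_mul, ← Real.rpow_natCast]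
    push_cast
    rfl

theorem two_le_pow_orbitSize (hq : 2 ≤ q) (s : ZMod a) : (2 : ℝ) ≤ (q : ℝ) ^ orbitSize a q s := by
  have : Nonempty {x : ZMod a // ∃ e : ℕ, (q : ZMod a) ^ e * s = x} := ⟨⟨s, 0, by simp⟩⟩
  have hl : orbitSize a q s ≠ 0 := Nat.card_pos.ne'
  have hq' : (2 : ℝ) ≤ q := by exact_mod_cast hq
  exact hq'.trans (le_self_pow₀ (by linarith) hl)

theorem quarter_pow_le_prod (T : Finset (ZMod a)) {y : T → ℝ} (hy : ∀ s, 1 / 4 ≤ y s) :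
    (1 / 4) ^ a ≤ ∏ s, y s := by
  have hcard : T.card ≤ a := (Finset.card_le_univ T).trans_eq (ZMod.card a)
  calc (1 / 4 : ℝ) ^ a ≤ (1 / 4) ^ T.card := pow_le_pow_of_le_one (by norm_num) (by norm_num) hcard
    _ = ∏ _s : T, (1 / 4 : ℝ) := by rw [Finset.prod_const, Finset.card_univ, Fintype.card_coe]
    _ ≤ ∏ s, y s := Finset.prod_le_prod (fun _ _ => by norm_num) fun s _ => hy s

omit [NeZero a] in
theorem div_nonneg_and_le {x y : ℝ} (hx0 : 0 ≤ x) (hx : x ≤ 1) (hy : (1 / 4) ^ a ≤ y) :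
    0 ≤ x / y ∧ x / y ≤ 4 ^ a := by
  have h4 : (0 : ℝ) < (1 / 4) ^ a := by positivity
  refine ⟨div_nonneg hx0 (h4.le.trans hy), ?_⟩
  rw [div_le_iff₀ (h4.trans_le hy)]
  calc x ≤ 1 := hx
    _ = 4 ^ a * (1 / 4) ^ a := by rw [← mul_pow]; norm_num
    _ ≤ 4 ^ a * y := by gcongr

theorem multWeight_bounds (hq : 2 ≤ q) (n : ℕ) (m : ZMod a → ℤ) :
    0 ≤ multWeight q n T m ∧ multWeight q n T m ≤ 4 ^ a := by
  have hq' : (2 : ℝ) ≤ q := by exact_mod_cast hq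
  rw [multWeight]
  split_ifs
  · exact div_nonneg_and_le (le_trans (by norm_num) (quarter_le_qPoch hq' n)) (qPoch_le_one hq' n)
      (quarter_pow_le_prod T fun s => quarter_le_qPoch (two_le_pow_orbitSize hq _) _)
  · exact ⟨le_rfl, by positivity⟩

theorem multConst_bounds (hq : 2 ≤ q) : 0 ≤ multConst q T ∧ multConst q T ≤ 4 ^ a := by
  have hq' : (2 : ℝ) ≤ q := by exact_mod_cast hq
  exact div_nonneg_and_le (le_trans (by norm_num) (quarter_le_qPochInf hq')) (qPochInf_le_one hq')
    (quarter_pow_le_prod T fun s => quarter_le_qPochInf (two_le_pow_orbitSize hq _))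

theorem abs_multWeight_sub_multConst_le (hq : 2 ≤ q) {n M : ℕ} {m : ZMod a → ℤ} (hMn : M ≤ n)
    (hm : ∀ i, (M : ℤ) ≤ m i) :
    |multWeight q n T m - multConst q T| ≤ (4 ^ a + 16 ^ a * a) * (1 / 2) ^ M := by
  have hq' : (2 : ℝ) ≤ q := by exact_mod_cast hq
  rw [multWeight, if_pos fun i => (Int.natCast_nonneg M).trans (hm i), multConst]
  have hx := abs_qPoch_sub_qPochInf_le hq' n
  have hx' := qPochInf_le_one hq'
  have hx0 : 0 ≤ qPochInf (q : ℝ) := le_trans (by norm_num) (quarter_le_qPochInf hq')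
  have hl := fun s : T => two_le_pow_orbitSize hq (s : ZMod a)
  have hcard : (T.card : ℝ) ≤ a := by
    exact_mod_cast (Finset.card_le_univ T).trans_eq (ZMod.card a)
  have hhalf : ∀ k : ℕ, M ≤ k → (1 / 2 : ℝ) ^ k ≤ (1 / 2) ^ M := fun k hk =>
    pow_le_pow_of_le_one (by norm_num) (by norm_num) hk
  have hy : |∏ s : T, qPochInf ((q : ℝ) ^ orbitSize a q s) -
      ∏ s : T, qPoch ((q : ℝ) ^ orbitSize a q s) (m s).toNat| ≤ a * (1 / 2) ^ M := by
    rw [abs_sub_comm]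
    refine (abs_prod_sub_prod_le Finset.univ le_rfl (δ := (1 / 2) ^ M) (fun s _ => ?_)
      (fun s _ => ?_) fun s _ => ?_).trans ?_
    · rw [abs_of_nonneg (le_trans (by norm_num) (quarter_le_qPoch (hl s) _))]
      exact qPoch_le_one (hl s) _
    · rw [abs_of_nonneg (le_trans (by norm_num) (quarter_le_qPochInf (hl s)))]
      exact qPochInf_le_one (hl s)
    · exact (abs_qPoch_sub_qPochInf_le (hl s) _).trans (hhalf _ (by have := hm s; omega))
    · rw [one_pow, mul_one, Finset.card_univ, Fintype.card_coe]
      gcongr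
  have h1 := quarter_pow_le_prod T fun s => quarter_le_qPoch (hl s) (m s).toNat
  have h2 := quarter_pow_le_prod T fun s => quarter_le_qPochInf (hl s)
  generalize ∏ s : T, qPochInf ((q : ℝ) ^ orbitSize a q s) = y' at *
  generalize ∏ s : T, qPoch ((q : ℝ) ^ orbitSize a q s) (m s).toNat = y at *
  generalize qPochInf (q : ℝ) = x' at *
  generalize qPoch (q : ℝ) n = x at *
  have h4 : (0 : ℝ) < (1 / 4) ^ a := by positivity
  have hy0 := h4.trans_le h1
  have hy0' := h4.trans_le h2
  have hinv : ∀ {t : ℝ}, (1 / 4) ^ a ≤ t → t⁻¹ ≤ 4 ^ a := fun {t} ht => by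
    rw [← inv_inv ((4 : ℝ) ^ a), ← inv_pow, ← one_div 4]
    exact inv_anti₀ h4 ht
  have heq : x / y - x' / y' = (x - x') * y⁻¹ + x' * (y' - y) * (y⁻¹ * y'⁻¹) := by
    field_simp
    ring
  rw [heq]
  calc |(x - x') * y⁻¹ + x' * (y' - y) * (y⁻¹ * y'⁻¹)|
      ≤ |x - x'| * y⁻¹ + x' * |y' - y| * (y⁻¹ * y'⁻¹) := by
        refine (abs_add_le _ _).trans_eq ?_
        rw [abs_mul, abs_mul, abs_mul x', abs_of_pos (inv_pos.mpr hy0), abs_of_nonneg hx0,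
          abs_of_pos (mul_pos (inv_pos.mpr hy0) (inv_pos.mpr hy0'))]
    _ ≤ (1 / 2) ^ M * 4 ^ a + 1 * (a * (1 / 2) ^ M) * (4 ^ a * 4 ^ a) := by
        have := hx.trans (hhalf n hMn)
        have := hinv h1
        have := hinv h2
        gcongr
    _ = (4 ^ a + 16 ^ a * a) * (1 / 2) ^ M := by
        rw [← mul_pow]
        norm_num
        ring

/-- Half of the Gaussian decay dominates the tail. -/
theorem rpow_energy_mul_abs_le (hq : 2 ≤ q) {n M : ℕ} (hM : M * (2 * a) ≤ n) (m : ZMod a → ℤ) :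
    (q : ℝ) ^ (-energy a n m) * |multWeight q n T m - multConst q T| ≤
      (4 ^ a + 16 ^ a * a) * (2 : ℝ) ^ (-((M : ℝ) / 2)) * (2 : ℝ) ^ (-(energy a n m / 2)) := by
  have ha : 0 < a := NeZero.pos a
  have hq' : (2 : ℝ) ≤ q := by exact_mod_cast hq
  have hE : 0 ≤ energy a n m := finsum_nonneg fun _ => sq_nonneg _
  have hqE : (q : ℝ) ^ (-energy a n m) ≤ (2 : ℝ) ^ (-(energy a n m / 2)) *
      (2 : ℝ) ^ (-(energy a n m / 2)) := by
    rw [← Real.rpow_add (by norm_num)]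
    refine (Real.rpow_le_rpow_of_nonpos (by norm_num) hq' (by linarith)).trans_eq ?_
    congr 1
    ring
  have hw1 : (2 : ℝ) ^ (-(energy a n m / 2)) ≤ 1 :=
    Real.rpow_le_one_of_one_le_of_nonpos (by norm_num) (by linarith)
  set w := (2 : ℝ) ^ (-(energy a n m / 2)) with hw
  have hw0 : 0 < w := by positivity
  by_cases hm : ∀ i, (M : ℤ) ≤ m i
  · have hd := abs_multWeight_sub_multConst_le (T := T) hq
      ((Nat.le_mul_of_pos_right M (by positivity)).trans hM) hm
    have hhalf : (1 / 2 : ℝ) ^ M ≤ (2 : ℝ) ^ (-((M : ℝ) / 2)) := by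
      rw [one_div, inv_pow, ← Real.rpow_natCast, ← Real.rpow_neg (by norm_num)]
      exact Real.rpow_le_rpow_of_exponent_le (by norm_num) (by linarith [Nat.cast_nonneg (α := ℝ) M])
    calc _ ≤ (w * w) * ((4 ^ a + 16 ^ a * a) * (1 / 2) ^ M) := by gcongr
      _ ≤ (w * 1) * ((4 ^ a + 16 ^ a * a) * (2 : ℝ) ^ (-((M : ℝ) / 2))) := by gcongr
      _ = _ := by ring
  · push Not at hm
    obtain ⟨i, hi⟩ := hm
    have hME : (M : ℝ) ≤ energy a n m := by
      have h1 : ((m i : ℝ) - n / a) ^ 2 ≤ energy a n m := by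
        rw [energy, finsum_eq_sum_of_fintype]
        exact Finset.single_le_sum (f := fun i => ((m i : ℝ) - n / a) ^ 2)
          (fun _ _ => sq_nonneg _) (Finset.mem_univ i)
      have h2 : (m i : ℝ) ≤ M := by exact_mod_cast hi.le
      have h3 : (2 : ℝ) * M ≤ n / a := by
        rw [le_div_iff₀ (by exact_mod_cast ha)]
        have : ((M * (2 * a) : ℕ) : ℝ) ≤ n := by exact_mod_cast hM
        push_cast at this
        linarith
      have h4 : (M : ℝ) ≤ (M : ℝ) ^ 2 := by exact_mod_cast Nat.le_self_pow two_ne_zero M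
      have h5 : (M : ℝ) ^ 2 ≤ ((m i : ℝ) - n / a) ^ 2 := by
        rw [← neg_sq ((m i : ℝ) - n / a)]
        exact pow_le_pow_left₀ (Nat.cast_nonneg M) (by linarith) 2
      linarith
    have hwM : w ≤ (2 : ℝ) ^ (-((M : ℝ) / 2)) :=
      Real.rpow_le_rpow_of_exponent_le (by norm_num) (by linarith)
    have hd : |multWeight q n T m - multConst q T| ≤ 4 ^ a + 16 ^ a * a := by
      have h1 := multWeight_bounds (T := T) hq n m
      have h2 := multConst_bounds (T := T) hq
      have h3 : (0 : ℝ) ≤ 16 ^ a * a := by positivity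
      rw [abs_le]
      constructor <;> linarith
    calc _ ≤ (w * w) * (4 ^ a + 16 ^ a * a) := by gcongr
      _ ≤ (w * (2 : ℝ) ^ (-((M : ℝ) / 2))) * (4 ^ a + 16 ^ a * a) := by gcongr
      _ = _ := by ring

theorem abs_tsum_multFn_le {Θ : ℝ}
    (hΘ : ∀ (y : ℝ) (s : Finset (ZMod a → ℤ)),
      ∑ m ∈ s, (2 : ℝ) ^ (-((∑ i, ((m i : ℝ) - y) ^ 2) / 2)) ≤ Θ)
    {n : ℕ} {k : ZMod a} {f : MultFn a q n k → ℝ} {c : ℝ} (hc : 0 ≤ c)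
    (hf : ∀ m, |f m| ≤ c * (2 : ℝ) ^ (-(energy a n m.1 / 2))) :
    Summable f ∧ |∑' m, f m| ≤ c * Θ := by
  have hbound : ∀ s : Finset (MultFn a q n k), ∑ m ∈ s, |f m| ≤ c * Θ := by
    intro s
    calc ∑ m ∈ s, |f m| ≤ ∑ m ∈ s, c * (2 : ℝ) ^ (-(energy a n m.1 / 2)) :=
          Finset.sum_le_sum fun m _ => hf m
      _ = c * ∑ m ∈ s.map (Function.Embedding.subtype _),
            (2 : ℝ) ^ (-((∑ i, ((m i : ℝ) - n / a) ^ 2) / 2)) := by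
          simp [energy, finsum_eq_sum_of_fintype, Finset.mul_sum]
      _ ≤ c * Θ := by gcongr; exact hΘ _ _
  have hs : Summable fun m => |f m| :=
    summable_of_sum_le (f := fun m => |f m|) (fun m => abs_nonneg (f m)) hbound
  refine ⟨hs.of_abs, ?_⟩
  calc |∑' m, f m| ≤ ∑' m, |f m| := by
        simp only [← Real.norm_eq_abs] at hs ⊢
        exact norm_tsum_le_tsum_norm hs
    _ ≤ c * Θ := hs.tsum_le_of_sum_le hbound

end Approx

section Uniform

open Filter Topology

theorem exists_uniform_approx (a : ℕ) [NeZero a] :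
    ∃ B : ℝ, 1 ≤ B ∧ ∀ δ > 0, ∃ N : ℕ, ∀ q : ℕ, q.Coprime a → ∀ n : ℕ, N < n →
      ∀ (F : Type) [Field F] [Fintype F], Fintype.card F = q →
      ∀ (L : Type) [Field L] [Algebra F L] (z : L), IsPrimitiveRoot z a →
      ∀ T : Finset (ZMod a), IsOrbitRepSet a q T → ∀ k : ZMod a,
      |Cconst a q n k T| ≤ B ∧
      |(Nat.card {t : GL (Fin n) F // t ^ a = 1 ∧
        algebraMap F L (t : Matrix (Fin n) (Fin n) F).det = z ^ k.val} : ℝ) *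
        (q : ℝ) ^ (-((1 - 1 / (a : ℝ)) * (n : ℝ) ^ 2))| ≤ B ∧
      |(Nat.card {t : GL (Fin n) F // t ^ a = 1 ∧
        algebraMap F L (t : Matrix (Fin n) (Fin n) F).det = z ^ k.val} : ℝ) *
        (q : ℝ) ^ (-((1 - 1 / (a : ℝ)) * (n : ℝ) ^ 2)) - Cconst a q n k T| ≤ δ := by
  obtain ⟨Θ, hΘ1, hΘ⟩ := exists_sum_pi_rpow_sq_le (ZMod a)
  refine ⟨4 ^ a * Θ, one_le_mul_of_one_le_of_one_le (one_le_pow₀ (by norm_num)) hΘ1,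
    fun δ hδ => ?_⟩
  have hlim : Tendsto (fun M : ℕ => (4 ^ a + 16 ^ a * a) * (2 : ℝ) ^ (-((M : ℝ) / 2)) * Θ) atTop
      (𝓝 ((4 ^ a + 16 ^ a * a) * 0 * Θ)) := by
    refine (Tendsto.const_mul _ ?_).mul_const _
    have : ∀ M : ℕ, (2 : ℝ) ^ (-((M : ℝ) / 2)) = ((2 : ℝ) ^ (-(1 / 2) : ℝ)) ^ M := by
      intro M
      rw [← Real.rpow_natCast, ← Real.rpow_mul (by norm_num)]
      congr 1
      ring
    simp_rw [this]
    exact tendsto_pow_atTop_nhds_zero_of_lt_one (by positivity)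
      (Real.rpow_lt_one_of_one_lt_of_neg (by norm_num) (by norm_num))
  rw [mul_zero, zero_mul] at hlim
  obtain ⟨M, hM⟩ := (hlim.eventually_le_const hδ).exists
  refine ⟨M * (2 * a), fun q hqa n hn F _ _ hq L _ _ z hz T hT k => ?_⟩
  have hq2 : 2 ≤ q := hq ▸ Fintype.one_lt_card
  have hq2' : (2 : ℝ) ≤ q := by exact_mod_cast hq2
  rw [natCard_mul_rpow_eq_tsum hz hq hqa hT, Cconst_eq_tsum hq2]
  have hqE : ∀ m : ZMod a → ℤ,
      (q : ℝ) ^ (-energy a n m) ≤ (2 : ℝ) ^ (-(energy a n m / 2)) := fun m => by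
    have hE : 0 ≤ energy a n m := finsum_nonneg fun _ => sq_nonneg _
    exact (Real.rpow_le_rpow_of_nonpos (by norm_num) hq2' (by linarith)).trans
      (Real.rpow_le_rpow_of_exponent_le (by norm_num) (by linarith))
  have hle : ∀ (m : ZMod a → ℤ) (u : ℝ), 0 ≤ u ∧ u ≤ 4 ^ a →
      |(q : ℝ) ^ (-energy a n m) * u| ≤ 4 ^ a * (2 : ℝ) ^ (-(energy a n m / 2)) := by
    rintro m u ⟨hu0, hu⟩
    rw [abs_of_nonneg (by positivity), mul_comm]
    have := hqE m
    gcongr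
  obtain ⟨hs1, hb1⟩ := abs_tsum_multFn_le hΘ (k := k) (by positivity) fun m : MultFn a q n k =>
    hle m.1 _ (multConst_bounds (T := T) hq2)
  obtain ⟨hs2, hb2⟩ := abs_tsum_multFn_le hΘ (k := k) (by positivity) fun m : MultFn a q n k =>
    hle m.1 _ (multWeight_bounds (T := T) hq2 n m.1)
  refine ⟨hb1, hb2, ?_⟩
  rw [← hs2.tsum_sub hs1]
  refine (abs_tsum_multFn_le hΘ (by positivity) fun m => ?_).2.trans hM
  rw [← mul_sub, abs_mul, abs_of_nonneg (Real.rpow_nonneg (by positivity) _)]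
  exact rpow_energy_mul_abs_le hq2 hn.le m.1

end Uniform

section Assembly

open scoped Classical in
theorem Jcard_eq_sum {F L : Type} [Field F] [Fintype F] [Field L] [Algebra F L] {r : ℕ}
    {a : Fin r → ℕ} [∀ i, NeZero (a i)] {z : Fin r → L} (hz : ∀ i, IsPrimitiveRoot (z i) (a i))
    (n : ℕ) :
    Jcard F n r a = ∑ k : {k : (i : Fin r) → ZMod (a i) | ∏ i, z i ^ (k i).val = 1},
      ∏ i, Nat.card {t : GL (Fin n) F // t ^ a i = 1 ∧
        algebraMap F L (t : Matrix (Fin n) (Fin n) F).det = z i ^ (k.1 i).val} := by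
  simp_rw [← Nat.card_pi]
  rw [← Nat.card_sigma, Jcard]
  let g : (Σ k : {k : (i : Fin r) → ZMod (a i) | ∏ i, z i ^ (k i).val = 1},
      ∀ i, {t : GL (Fin n) F // t ^ a i = 1 ∧
        algebraMap F L (t : Matrix (Fin n) (Fin n) F).det = z i ^ (k.1 i).val}) →
      {t : Fin r → GL (Fin n) F //
        (∀ i, t i ^ a i = 1) ∧ ∏ i, ((t i : Matrix (Fin n) (Fin n) F).det) = 1} := fun p =>
    ⟨fun i => (p.2 i).1, fun i => (p.2 i).2.1, (algebraMap F L).injective <| by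
      rw [map_prod, map_one]
      exact (Finset.prod_congr rfl fun i _ => (p.2 i).2.2).trans p.1.2⟩
  refine (Nat.card_congr (Equiv.ofBijective g ⟨?_, ?_⟩)).symm
  · rintro ⟨⟨k, hk⟩, t⟩ ⟨⟨k', hk'⟩, t'⟩ h
    have ht : ∀ i, (t i).1 = (t' i).1 := congrFun (congrArg Subtype.val h)
    obtain rfl : k = k' := funext fun i => (hz i).pow_val_inj.mp (by
      rw [← (t i).2.2, ht, (t' i).2.2])
    obtain rfl : t = t' := funext fun i => Subtype.ext (ht i)
    rfl
  · rintro ⟨t, ht, hdet⟩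
    have hpow : ∀ i, ∃ k : ZMod (a i),
        algebraMap F L (t i : Matrix (Fin n) (Fin n) F).det = z i ^ k.val := by
      intro i
      have h1 : (algebraMap F L (t i : Matrix (Fin n) (Fin n) F).det) ^ a i = 1 := by
        rw [← map_pow, ← Matrix.det_pow, ← Units.val_pow_eq_pow_val, ht i, Units.val_one,
          Matrix.det_one, map_one]
      obtain ⟨k, -, hk⟩ := (hz i).eq_pow_of_pow_eq_one h1
      exact ⟨k, by rw [(hz i).pow_val_natCast, hk]⟩
    choose k hk using hpow
    refine ⟨⟨⟨k, ?_⟩, fun i => ⟨t i, ht i, hk i⟩⟩, rfl⟩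
    simp_rw [Set.mem_ofPred_eq, ← hk]
    rw [← map_prod, hdet, map_one]

end Assembly

theorem stmt_11 (r : ℕ) (a : Fin r → ℕ) (ha : ∀ i, 0 < a i)
    (ε : ℝ) (hε : 0 < ε) :
    ∃ N : ℕ, ∀ q : ℕ, IsPrimePow q → Nat.Coprime q (Finset.univ.lcm a) →
      ∀ n : ℕ, N < n →
      ∀ (F : Type) [Field F] [Fintype F], Fintype.card F = q →
      ∀ ζ : AlgebraicClosure F, IsPrimitiveRoot ζ (Finset.univ.lcm a) →
      ∀ T : (i : Fin r) → Finset (ZMod (a i)), (∀ i, IsOrbitRepSet (a i) q (T i)) →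
      |(Jcard F n r a : ℝ) *
            (q : ℝ) ^ (-(((r : ℝ) - ∑ i, 1 / (a i : ℝ)) * (n : ℝ) ^ 2)) -
          ∑ᶠ k ∈ {k : (i : Fin r) → ZMod (a i) |
              ∏ i, (ζ ^ (Finset.univ.lcm a / a i)) ^ (k i).val = 1},
            ∏ i, Cconst (a i) q n (k i) (T i)| < ε := by
  classical
  have hne : ∀ i, NeZero (a i) := fun i => ⟨(ha i).ne'⟩
  have hA : 0 < Finset.univ.lcm a := Nat.pos_of_ne_zero fun h => by
    obtain ⟨i, -, hi⟩ := Finset.lcm_eq_zero_iff.mp h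
    exact (ha i).ne' hi
  choose B hB1 hB using fun i => exists_uniform_approx (a i)
  let B' : ℝ := 1 + ∑ i, B i
  have hBB' : ∀ i, B i ≤ B' := fun i => by
    have := Finset.single_le_sum (f := B) (fun j _ => zero_le_one.trans (hB1 j))
      (Finset.mem_univ i)
    linarith
  have hB'1 : 1 ≤ B' :=
    le_add_of_nonneg_right (Finset.sum_nonneg fun j _ => zero_le_one.trans (hB1 j))
  let P : ℝ := Fintype.card ((i : Fin r) → ZMod (a i)) * (r * B' ^ r)
  have hP : 0 ≤ P := by positivity
  let δ : ℝ := ε / (P + 1)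
  have hδ : 0 < δ := by positivity
  choose N hN using fun i => hB i δ hδ
  refine ⟨∑ i, N i, fun q _ hqA n hn F _ _ hq ζ hζ T hT => ?_⟩
  have hq0 : (0 : ℝ) < q := by rw [← hq]; exact_mod_cast Fintype.card_pos
  have hdvd : ∀ i, a i ∣ Finset.univ.lcm a := fun i => Finset.dvd_lcm (Finset.mem_univ i)
  have hz : ∀ i, IsPrimitiveRoot (ζ ^ (Finset.univ.lcm a / a i)) (a i) := fun i =>
    hζ.pow hA (Nat.div_mul_cancel (hdvd i)).symm
  have happrox := fun i => hN i q (hqA.coprime_dvd_right (hdvd i)) n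
    ((Finset.single_le_sum (fun _ _ => Nat.zero_le _) (Finset.mem_univ i)).trans_lt hn) F hq
    (AlgebraicClosure F) _ (hz i) (T i) (hT i)
  have hpow : (q : ℝ) ^ (-(((r : ℝ) - ∑ i, 1 / (a i : ℝ)) * (n : ℝ) ^ 2)) =
      ∏ i, (q : ℝ) ^ (-((1 - 1 / (a i : ℝ)) * (n : ℝ) ^ 2)) := by
    rw [← Real.rpow_sum_of_pos hq0, Finset.sum_neg_distrib, ← Finset.sum_mul,
      Finset.sum_sub_distrib]
    simp
  rw [← finsum_set_coe_eq_finsum_mem, finsum_eq_sum_of_fintype, Jcard_eq_sum hz, hpow,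
    Nat.cast_sum, Finset.sum_mul, ← Finset.sum_sub_distrib]
  simp_rw [Nat.cast_prod, ← Finset.prod_mul_distrib]
  have hterm : ∀ k : (i : Fin r) → ZMod (a i), _ := fun k =>
    abs_prod_sub_prod_le Finset.univ hB'1 (fun i _ => (happrox i (k i)).2.1.trans (hBB' i))
      (fun i _ => (happrox i (k i)).1.trans (hBB' i)) fun i _ => (happrox i (k i)).2.2
  rw [Finset.card_univ, Fintype.card_fin] at hterm
  refine (Finset.abs_sum_le_sum_abs _ _).trans_lt
    ((Finset.sum_le_sum fun k _ => hterm k.1).trans_lt ?_)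
  rw [Finset.sum_const, nsmul_eq_mul, Finset.card_univ]
  calc _ ≤ (Fintype.card ((i : Fin r) → ZMod (a i)) : ℝ) * (r * B' ^ r * δ) := by
        gcongr
        exact Fintype.card_subtype_le _
    _ = P * (ε / (P + 1)) := by simp only [P, δ]; ring
    _ < ε := by
        rw [mul_div_assoc', div_lt_iff₀ (by positivity)]
        linarith
end

section
/- Let a ≥ 2 and n ≥ 1 be integers and q a prime power with q ≡ 1 (mod a). Then: (1) every t ∈ GL_n(F_q) with t^a = 1 satisfies Σ_{i ∈ ℤ/aℤ} m_i(t)² ≥ n²/a + a·{n/a}·{−n/a}; and (2) there exists t ∈ GL_n(F_q) with t^a = 1 and Σ_{i ∈ ℤ/aℤ} m_i(t)² = n²/a + a·{n/a}·{−n/a}. Here {x} denotes the fractional part of the real number x. -/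
open scoped MatrixGroups

/-- The multiplicity `m_i(t)` of `ζ^i` as an eigenvalue of `t` (over the algebraic
closure), namely the multiplicity of `ζ^i` as a root of the characteristic
polynomial of `t`. -/
noncomputable def eigMult {F : Type} [Field F] {n : ℕ} (a : ℕ)
    (ζ : AlgebraicClosure F) (t : GL (Fin n) F) (i : ZMod a) : ℕ :=
  Polynomial.rootMultiplicity (ζ ^ i.val)
    (Matrix.charpoly ((t : Matrix (Fin n) (Fin n) F).map (algebraMap F (AlgebraicClosure F))))

theorem finsum_sq_sub_eq {ι : Type*} [Fintype ι] (m : ι → ℕ) (n k : ℕ) (hm : ∑ i, m i = n) :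
    ∑ i, ((m i : ℝ) - k) * ((m i : ℝ) - (k + 1)) =
      (∑ᶠ i, (m i : ℝ) ^ 2) - ((2 * k + 1) * n - Fintype.card ι * (k * (k + 1))) := by
  have hm' : (n : ℝ) = ∑ i, (m i : ℝ) := by rw [← hm]; push_cast; rfl
  rw [finsum_eq_sum_of_fintype, hm', Finset.mul_sum, ← Finset.card_univ, ← nsmul_eq_mul,
    ← Finset.sum_const, ← Finset.sum_sub_distrib, ← Finset.sum_sub_distrib]
  exact Finset.sum_congr rfl fun i _ => by ring

theorem sq_div_add_mul_fract_mul_fract (a n : ℕ) (ha : 0 < a) :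
    (n : ℝ) ^ 2 / (a : ℝ) +
        (a : ℝ) * Int.fract ((n : ℝ) / (a : ℝ)) * Int.fract (-(n : ℝ) / (a : ℝ)) =
      (2 * (n / a : ℕ) + 1) * n - a * ((n / a : ℕ) * ((n / a : ℕ) + 1)) := by
  have ha' : (0 : ℝ) < a := by exact_mod_cast ha
  have hdiv : (n : ℝ) = a * (n / a : ℕ) + (n % a : ℕ) := by
    exact_mod_cast (Nat.div_add_mod n a).symm
  have hlt : ((n % a : ℕ) : ℝ) < a := by exact_mod_cast Nat.mod_lt n ha
  generalize n / a = k at *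
  generalize n % a = r at *
  have hr : (0 : ℝ) ≤ r := Nat.cast_nonneg r
  have hfract : Int.fract ((n : ℝ) / a) = r / a := by
    rw [Int.fract_eq_iff]
    refine ⟨by positivity, (div_lt_one ha').2 hlt, k, ?_⟩
    rw [hdiv]; push_cast; field_simp; ring
  rw [neg_div]
  rcases hr.eq_or_lt with h0 | h0
  · rw [hfract, hdiv, ← h0]
    simp only [zero_div, mul_zero, zero_mul, add_zero]
    field_simp; ring
  · rw [Int.fract_neg (by rw [hfract]; positivity), hfract, hdiv]
    field_simp; ring

theorem sum_eigMult {F : Type} [Field F] {n a : ℕ} [NeZero a] {ζ : AlgebraicClosure F}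
    (hζ : IsPrimitiveRoot ζ a) {t : GL (Fin n) F} (ht : t ^ a = 1) :
    ∑ i : ZMod a, eigMult a ζ t i = n := by
  classical
  unfold eigMult
  set M := (t : Matrix (Fin n) (Fin n) F).map (algebraMap F (AlgebraicClosure F)) with hM
  have hMa : M ^ a = 1 := by
    have h : (t : Matrix (Fin n) (Fin n) F) ^ a = 1 := by
      rw [← Units.val_pow_eq_pow_val, ht, Units.val_one]
    have h2 := congrArg (algebraMap F (AlgebraicClosure F)).mapMatrix h
    rwa [map_pow, map_one] at h2
  have hinj : Function.Injective fun i : ZMod a => ζ ^ i.val := fun i j hij =>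
    ZMod.val_injective a (hζ.pow_inj (ZMod.val_lt i) (ZMod.val_lt j) hij)
  have hroots : ∀ μ ∈ M.charpoly.roots,
      μ ∈ Finset.univ.image fun i : ZMod a => ζ ^ i.val := by
    intro μ hμ
    have hs : μ ∈ spectrum _ M :=
      Matrix.mem_spectrum_iff_isRoot_charpoly.2 (Polynomial.isRoot_of_mem_roots hμ)
    have hpow := spectrum.pow_mem_pow M a hs
    have : Nontrivial (Matrix (Fin n) (Fin n) (AlgebraicClosure F)) := by
      by_contra h
      rw [not_nontrivial_iff_subsingleton] at h
      rw [spectrum.of_subsingleton] at hs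
      exact hs
    rw [hMa, spectrum.one_eq, Set.mem_singleton_iff] at hpow
    obtain ⟨i, hi, rfl⟩ := hζ.eq_pow_of_pow_eq_one hpow
    exact Finset.mem_image.2 ⟨i, Finset.mem_univ _, by rw [ZMod.val_cast_of_lt hi]⟩
  have hcount := Multiset.sum_count_eq_card hroots
  rw [Finset.sum_image hinj.injOn,
    Polynomial.splits_iff_card_roots.1 (IsAlgClosed.splits M.charpoly),
    Matrix.charpoly_natDegree_eq_dim, Fintype.card_fin] at hcount
  simpa only [Polynomial.count_roots] using hcount

theorem exists_algebraMap_eq_of_isPrimitiveRoot {F K : Type*} [Field F] [Fintype F] [Field K]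
    [Algebra F K] {a : ℕ} (ha : 0 < a) (hF : a ∣ Fintype.card F - 1) {ζ : K}
    (hζ : IsPrimitiveRoot ζ a) : ∃ z : F, algebraMap F K z = ζ := by
  have hpos : 0 < Fintype.card F - 1 := Nat.sub_pos_of_lt Fintype.one_lt_card
  obtain ⟨g, hg⟩ := IsCyclic.exists_ofOrder_eq_natCard (α := Fˣ)
  rw [Nat.card_units, Nat.card_eq_fintype_card] at hg
  obtain ⟨b, hb⟩ := hF
  have hprim := (IsPrimitiveRoot.orderOf g).pow (a := b) (b := a) (hg ▸ hpos)
    (by rw [hg, hb, mul_comm])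
  have hprim' : IsPrimitiveRoot (algebraMap F K ((g ^ b : Fˣ) : F)) a :=
    (IsPrimitiveRoot.coe_units_iff.2 hprim).map_of_injective (algebraMap F K).injective
  have : NeZero a := ⟨ha.ne'⟩
  obtain ⟨i, -, hi⟩ := hprim'.eq_pow_of_pow_eq_one hζ.pow_eq_one
  exact ⟨_, (map_pow _ _ _).trans hi⟩

theorem exists_pow_eq_one_eigMult_eq {F : Type} [Field F] (n : ℕ) {a : ℕ} [NeZero a] {z : F}
    (hζ : IsPrimitiveRoot (algebraMap F (AlgebraicClosure F) z) a) :
    ∃ t : GL (Fin n) F, t ^ a = 1 ∧ ∀ i : ZMod a,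
      eigMult a (algebraMap F (AlgebraicClosure F) z) t i =
        n / a + if i.val < n % a then 1 else 0 := by
  classical
  have hz : z ^ a = 1 := (algebraMap F (AlgebraicClosure F)).injective (by
    rw [map_pow, hζ.pow_eq_one, map_one])
  have hD : (Matrix.diagonal fun j : Fin n => z ^ (j : ℕ)) ^ a = 1 := by
    rw [Matrix.diagonal_pow, ← Matrix.diagonal_one]
    congr 1
    ext j
    rw [Pi.pow_apply, ← pow_mul, mul_comm, pow_mul, hz, one_pow]
  refine ⟨Units.ofPowEqOne _ a hD (NeZero.ne a), Units.pow_ofPowEqOne _ _, fun i => ?_⟩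
  unfold eigMult
  set ζ := algebraMap F (AlgebraicClosure F) z
  have hchar : (Matrix.map (Matrix.diagonal fun j : Fin n => z ^ (j : ℕ))
      (algebraMap F (AlgebraicClosure F))).charpoly =
      ((Finset.univ.val.map fun j : Fin n => ζ ^ (j : ℕ)).map
        fun x => Polynomial.X - Polynomial.C x).prod := by
    rw [Matrix.diagonal_map (map_zero _), Matrix.charpoly_of_isUpperTriangular _
      (Matrix.blockTriangular_diagonal _), Multiset.map_map]
    simp [ζ, Finset.prod]
  rw [Units.val_ofPowEqOne, hchar, ← Polynomial.count_roots, Polynomial.roots_multiset_prod_X_sub_C,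
    Multiset.count_map]
  have hmod : ∀ j : ℕ, ζ ^ i.val = ζ ^ j ↔ j ≡ i.val [MOD a] := fun j => by
    rw [← pow_mod_orderOf ζ j, ← hζ.eq_orderOf, Nat.ModEq, Nat.mod_eq_of_lt (ZMod.val_lt i)]
    exact ⟨fun h => (hζ.pow_inj (ZMod.val_lt i) (Nat.mod_lt _ (NeZero.pos a)) h).symm,
      fun h => by rw [h]⟩
  have hcount := Nat.count_modEq_card n (NeZero.pos a) i.val
  rw [Nat.mod_eq_of_lt (ZMod.val_lt i), Nat.count_eq_card_filter_range] at hcount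
  rw [← hcount, Finset.card_filter, Finset.sum_range, ← Finset.card_filter]
  simp only [hmod]
  rfl

theorem stmt_16 (a n q : ℕ) (ha : 2 ≤ a) (hn : 1 ≤ n) (hq : IsPrimePow q)
    (hqa : q % a = 1)
    (F : Type) [Field F] [Fintype F] (hF : Fintype.card F = q)
    (ζ : AlgebraicClosure F) (hζ : IsPrimitiveRoot ζ a) :
    (∀ t : GL (Fin n) F, t ^ a = 1 →
      (n : ℝ) ^ 2 / (a : ℝ) +
          (a : ℝ) * Int.fract ((n : ℝ) / (a : ℝ)) * Int.fract (-(n : ℝ) / (a : ℝ)) ≤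
        ∑ᶠ i : ZMod a, (eigMult a ζ t i : ℝ) ^ 2) ∧
    (∃ t : GL (Fin n) F, t ^ a = 1 ∧
      ∑ᶠ i : ZMod a, (eigMult a ζ t i : ℝ) ^ 2 =
        (n : ℝ) ^ 2 / (a : ℝ) +
          (a : ℝ) * Int.fract ((n : ℝ) / (a : ℝ)) * Int.fract (-(n : ℝ) / (a : ℝ))) := by
  have ha0 : 0 < a := by omega
  have : NeZero a := ⟨ha0.ne'⟩
  have hnonneg : ∀ m k : ℕ, (0 : ℝ) ≤ ((m : ℝ) - k) * ((m : ℝ) - (k + 1)) := fun m k => by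
    rcases le_or_gt m k with h | h
    · have h' : (m : ℝ) ≤ k := by exact_mod_cast h
      nlinarith
    · have h' : (k : ℝ) + 1 ≤ m := by exact_mod_cast h
      nlinarith
  rw [sq_div_add_mul_fract_mul_fract a n ha0]
  refine ⟨fun t ht => ?_, ?_⟩
  · have h := finsum_sq_sub_eq _ n (n / a) (sum_eigMult hζ ht)
    rw [ZMod.card] at h
    have hsum := Finset.sum_nonneg fun (i : ZMod a) (_ : i ∈ Finset.univ) =>
      hnonneg (eigMult a ζ t i) (n / a)
    linarith
  · have hdvd : a ∣ Fintype.card F - 1 := by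
      rw [hF]
      exact (Nat.modEq_iff_dvd' hq.pos).1 (by rw [Nat.ModEq, hqa, Nat.mod_eq_of_lt ha])
    obtain ⟨z, rfl⟩ := exists_algebraMap_eq_of_isPrimitiveRoot ha0 hdvd hζ
    obtain ⟨t, ht, hmult⟩ := exists_pow_eq_one_eigMult_eq n hζ
    refine ⟨t, ht, ?_⟩
    have h := finsum_sq_sub_eq _ n (n / a) (sum_eigMult hζ ht)
    rw [ZMod.card, Finset.sum_eq_zero fun i _ => ?_] at h
    · linarith
    · rw [hmult]
      split_ifs <;> push_cast <;> ring
end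

section
/- Let a ≥ 2 and k be integers with 0 < k < a. Then for every residue class c modulo a there exists a k-element subset S of {0, 1, …, a−1} such that Σ_{s ∈ S} s ≡ c (mod a). -/
/-- The sums of the `k`-element subsets of `{0, …, k + d - 1}` include every integer from the
smallest such sum `0 + 1 + ⋯ + (k - 1)` up to that sum plus `k * d`. -/
theorem exists_subset_range_card_eq_sum_eq (k d m : ℕ) (hm : m ≤ k * d) :
    ∃ S : Finset ℕ, S ⊆ Finset.range (k + d) ∧ S.card = k ∧
      ∑ s ∈ S, s = ∑ s ∈ Finset.range k, s + m := by
  induction k generalizing d m with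
  | zero => exact ⟨∅, by simp, by simp, by simp; lia⟩
  | succ k ihk =>
    induction d generalizing m with
    | zero => exact ⟨Finset.range (k + 1), by simp, by simp, by lia⟩
    | succ d ihd =>
      by_cases h : m ≤ (k + 1) * d
      · obtain ⟨S, hS, hcard, hsum⟩ := ihd m h
        exact ⟨S, hS.trans (Finset.range_subset_range.2 (by lia)), hcard, hsum⟩
      · have hd : d + 1 ≤ m := by nlinarith
        obtain ⟨S, hS, hcard, hsum⟩ := ihk (d + 1) (m - (d + 1)) (by
          rw [tsub_le_iff_right]; linarith)
        have hnot : k + (d + 1) ∉ S := fun hmem => by simpa using hS hmem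
        refine ⟨insert (k + (d + 1)) S, ?_, ?_, ?_⟩
        · refine Finset.insert_subset (Finset.mem_range.2 (by lia)) ?_
          exact hS.trans (Finset.range_subset_range.2 (by lia))
        · rw [Finset.card_insert_of_notMem hnot, hcard]
        · rw [Finset.sum_insert hnot, hsum, Finset.sum_range_succ]
          lia

theorem stmt_19 (a k : ℕ) (ha : 2 ≤ a) (hk0 : 0 < k) (hka : k < a) (c : ZMod a) :
    ∃ S : Finset ℕ, S ⊆ Finset.range a ∧ S.card = k ∧ ((∑ s ∈ S, s : ℕ) : ZMod a) = c := by
  have : NeZero a := ⟨by lia⟩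
  obtain ⟨d, rfl⟩ := Nat.exists_eq_add_of_lt hka
  set r : ZMod (k + d + 1) := c - ((∑ s ∈ Finset.range k, s : ℕ) : ZMod (k + d + 1)) with hr
  have hlt := ZMod.val_lt r
  obtain ⟨S, hS, hcard, hsum⟩ :=
    exists_subset_range_card_eq_sum_eq k (d + 1) r.val (by nlinarith)
  refine ⟨S, hS, hcard, ?_⟩
  rw [hsum, Nat.cast_add, ZMod.natCast_zmod_val, hr, add_sub_cancel]
end
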